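/- arXiv:2512.15409 — 3 statements merged into one kernel-verified Lean document; each statement's English description precedes it below -/
import Mathlib

section
/- Let ω be a subadditive weight function with Young conjugate φ*_ω. Let φ:ℝ→ℝ be a smooth function with φ′ ∈ B_{L∞,ω}(ℝ), and set σ(x,y) = exp(i φ(x)y). Then for every ℓ ∈ ℕ there exists m_ℓ > 0 such that |∂_x^n σ(x,y)| ≤ 4^n · e^{m_ℓ·ω(|y|)} · e^{ℓ·φ*_ω(n/ℓ)} for all n ∈ ℕ, n ≥ 1, and all x, y ∈ ℝ. -/
open MeasureTheory

/-- A subadditive weight function in the sense of Braun–Meise–Taylor. -/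
structure IsWeightFunction (ω : ℝ → ℝ) : Prop where
  continuous : Continuous ω
  monotone : MonotoneOn ω (Set.Ici 0)
  nonneg : ∀ t : ℝ, 0 ≤ t → 0 ≤ ω t
  subadditive : ∀ s t : ℝ, 0 ≤ s → 0 ≤ t → ω (s + t) ≤ ω s + ω t
  integral : IntegrableOn (fun t : ℝ => ω t / (1 + t ^ 2)) (Set.Ioi 0)
  growth : (fun t : ℝ => Real.log (1 + t ^ 2)) =o[Filter.atTop] ω
  convex : ConvexOn ℝ Set.univ fun t : ℝ => ω (Real.exp t)

/-- The Young conjugate `φ*_ω(s) = sup_{t ≥ 0} (s·t − ω(eᵗ))`. -/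
noncomputable def youngConj (ω : ℝ → ℝ) (s : ℝ) : ℝ :=
  sSup ((fun t : ℝ => s * t - ω (Real.exp t)) '' Set.Ici 0)

lemma IsWeightFunction.map_nat_mul_le {ω : ℝ → ℝ} (hω : IsWeightFunction ω) (n : ℕ) {t : ℝ}
    (ht : 0 ≤ t) : ω (((n + 1 : ℕ) : ℝ) * t) ≤ ((n + 1 : ℕ) : ℝ) * ω t := by
  induction n with
  | zero => simp
  | succ n ih =>
    have h := hω.subadditive (((n + 1 : ℕ) : ℝ) * t) t (by positivity) ht
    have e : ((n + 1 + 1 : ℕ) : ℝ) * t = ((n + 1 : ℕ) : ℝ) * t + t := by push_cast; ring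
    rw [e]
    push_cast at *
    linarith

lemma IsWeightFunction.bddAbove {ω : ℝ → ℝ} (hω : IsWeightFunction ω) {s : ℝ} (hs : 0 ≤ s) :
    BddAbove ((fun t : ℝ => s * t - ω (Real.exp t)) '' Set.Ici 0) := by
  have h := hω.growth.bound (show (0 : ℝ) < 1 / (s + 1) by positivity)
  obtain ⟨U, hU⟩ := Filter.eventually_atTop.1 h
  refine ⟨s * |U|, ?_⟩
  rintro _ ⟨t, ht, rfl⟩
  have ht : 0 ≤ t := ht
  have h0 := hω.nonneg _ (Real.exp_pos t).le
  have hte : t ≤ Real.exp t := by linarith [Real.add_one_le_exp t]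
  dsimp only
  by_cases hc : U ≤ Real.exp t
  · have h1 := hU _ hc
    have h2 : t ≤ Real.log (1 + Real.exp t ^ 2) := by
      rw [Real.le_log_iff_exp_le (by positivity)]
      nlinarith [sq_nonneg (Real.exp t - 1), Real.exp_pos t]
    rw [Real.norm_of_nonneg (ht.trans h2), Real.norm_of_nonneg h0, one_div_mul_eq_div,
      le_div_iff₀ (by positivity)] at h1
    have : 0 ≤ s * |U| := by positivity
    nlinarith
  · have : t ≤ |U| := by linarith [le_abs_self U]
    nlinarith

/-- The sequence `k ↦ exp (ℓ φ*_ω(k / ℓ))` attached to a weight function. -/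
noncomputable def weightSeq (ω : ℝ → ℝ) (ℓ k : ℕ) : ℝ :=
  Real.exp ((ℓ : ℝ) * youngConj ω ((k : ℝ) / ℓ))

lemma weightSeq_pos (ω : ℝ → ℝ) (ℓ k : ℕ) : 0 < weightSeq ω ℓ k := Real.exp_pos _

lemma IsWeightFunction.pow_le_weightSeq {ω : ℝ → ℝ} (hω : IsWeightFunction ω) {ℓ : ℕ}
    (hℓ : 1 ≤ ℓ) (k : ℕ) {u : ℝ} (hu : 1 ≤ u) :
    u ^ k ≤ Real.exp (ℓ * ω u) * weightSeq ω ℓ k := by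
  have hℓ' : (0 : ℝ) < ℓ := by exact_mod_cast hℓ
  have hu0 : 0 < u := by linarith
  have h : (k : ℝ) / ℓ * Real.log u - ω (Real.exp (Real.log u)) ≤ youngConj ω ((k : ℝ) / ℓ) :=
    le_csSup (hω.bddAbove (by positivity)) ⟨Real.log u, Real.log_nonneg hu, rfl⟩
  rw [Real.exp_log hu0] at h
  rw [weightSeq, ← Real.exp_add, ← Real.log_le_iff_le_exp (by positivity), Real.log_pow]
  have := mul_le_mul_of_nonneg_left h hℓ'.le
  have e : (ℓ : ℝ) * ((k : ℝ) / ℓ * Real.log u - ω u) = k * Real.log u - ℓ * ω u := by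
    field_simp
  linarith

lemma weightSeq_le {ω : ℝ → ℝ} {ℓ : ℕ} (hℓ : 1 ≤ ℓ) {k : ℕ} {B : ℝ} (hB : 0 < B)
    (h : ∀ u : ℝ, 1 ≤ u → u ^ k ≤ Real.exp (ℓ * ω u) * B) : weightSeq ω ℓ k ≤ B := by
  have hℓ' : (0 : ℝ) < ℓ := by exact_mod_cast hℓ
  rw [weightSeq, ← Real.le_log_iff_exp_le hB, mul_comm, ← le_div_iff₀ hℓ']
  refine csSup_le (Set.Nonempty.image _ ⟨0, Set.mem_Ici.2 le_rfl⟩) ?_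
  rintro _ ⟨t, ht, rfl⟩
  have h1 := h (Real.exp t) (Real.one_le_exp ht)
  rw [← Real.exp_log hB, ← Real.exp_nat_mul, ← Real.exp_add, Real.exp_le_exp] at h1
  rw [le_div_iff₀ hℓ']
  have e : ((k : ℝ) / ℓ * t - ω (Real.exp t)) * ℓ = k * t - ℓ * ω (Real.exp t) := by
    field_simp
  dsimp only
  linarith

lemma IsWeightFunction.choose_mul_weightSeq_mul_le {ω : ℝ → ℝ} (hω : IsWeightFunction ω) {ℓ : ℕ}
    (hℓ : 1 ≤ ℓ) (j k : ℕ) :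
    ((j + k).choose j : ℝ) * (weightSeq ω ℓ j * weightSeq ω ℓ k) ≤ weightSeq ω ℓ (j + k) := by
  have hC : (0 : ℝ) < (j + k).choose j := by exact_mod_cast Nat.choose_pos (Nat.le_add_right j k)
  have hW := weightSeq_pos ω ℓ
  have key : ∀ s t : ℝ, 1 ≤ s → 1 ≤ t → ((j + k).choose j : ℝ) * (s ^ j * t ^ k) ≤
      Real.exp (ℓ * ω s) * Real.exp (ℓ * ω t) * weightSeq ω ℓ (j + k) := by
    intro s t hs ht
    have h1 : ((j + k).choose j : ℝ) * (s ^ j * t ^ k) ≤ (s + t) ^ (j + k) := by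
      rw [add_pow]
      refine le_trans (le_of_eq ?_) (Finset.single_le_sum
        (f := fun m => s ^ m * t ^ (j + k - m) * ((j + k).choose m : ℝ))
        (fun m _ => by positivity) (Finset.mem_range.2 (show j < j + k + 1 by omega)))
      simp only [Nat.add_sub_cancel_left]
      ring
    refine h1.trans ((hω.pow_le_weightSeq hℓ (j + k) (by linarith)).trans ?_)
    rw [← Real.exp_add, ← mul_add]
    have := hω.subadditive s t (by linarith) (by linarith)
    have := (hW (j + k)).le
    gcongr
  have h1 : ∀ t : ℝ, 1 ≤ t → ((j + k).choose j : ℝ) * (weightSeq ω ℓ j * t ^ k) ≤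
      Real.exp (ℓ * ω t) * weightSeq ω ℓ (j + k) := by
    intro t ht
    have hpos : 0 < ((j + k).choose j : ℝ) * t ^ k := by positivity
    have := weightSeq_le (ω := ω) hℓ (k := j)
      (B := Real.exp (ℓ * ω t) * weightSeq ω ℓ (j + k) / (((j + k).choose j : ℝ) * t ^ k))
      (by have := hW (j + k); positivity) (fun u hu => by
        rw [mul_div_assoc', le_div_iff₀ hpos]
        linarith [key u t hu ht])
    rw [le_div_iff₀ hpos] at this
    linarith
  have hpos : 0 < ((j + k).choose j : ℝ) * weightSeq ω ℓ j := mul_pos hC (hW j)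
  have := weightSeq_le (ω := ω) hℓ (k := k)
    (B := weightSeq ω ℓ (j + k) / (((j + k).choose j : ℝ) * weightSeq ω ℓ j))
    (div_pos (hW _) hpos) (fun u hu => by
      rw [mul_div_assoc', le_div_iff₀ hpos]
      linarith [h1 u hu])
  rw [le_div_iff₀ hpos] at this
  linarith

lemma IsWeightFunction.weightSeq_succ_le {ω : ℝ → ℝ} (hω : IsWeightFunction ω) {ℓ : ℕ}
    (hℓ : 1 ≤ ℓ) (k : ℕ) :
    weightSeq ω (ℓ + 1) (k + 1) ≤ weightSeq ω 1 1 * weightSeq ω ℓ k := by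
  refine weightSeq_le (by omega) (mul_pos (weightSeq_pos _ _ _) (weightSeq_pos _ _ _)) ?_
  intro u hu
  have h1 := hω.pow_le_weightSeq hℓ k hu
  have h2 := hω.pow_le_weightSeq le_rfl 1 hu
  have e : Real.exp (((ℓ + 1 : ℕ) : ℝ) * ω u) =
      Real.exp (ℓ * ω u) * Real.exp (((1 : ℕ) : ℝ) * ω u) := by
    rw [← Real.exp_add]; push_cast; ring_nf
  rw [e, pow_succ]
  calc u ^ k * u ≤ (Real.exp (ℓ * ω u) * weightSeq ω ℓ k) *
        (Real.exp (((1 : ℕ) : ℝ) * ω u) * weightSeq ω 1 1) :=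
        mul_le_mul h1 (by simpa using h2) (by linarith) ((by positivity : 0 ≤ u ^ k).trans h1)
    _ = _ := by ring

lemma IsWeightFunction.pos {ω : ℝ → ℝ} (hω : IsWeightFunction ω) {t : ℝ} (ht : 0 < t) :
    0 < ω t := by
  refine lt_of_le_of_ne (hω.nonneg t ht.le) fun h0 => ?_
  obtain ⟨n, hn⟩ := exists_nat_gt ((weightSeq ω 1 1 + 1) / t)
  rw [div_lt_iff₀ ht] at hn
  have hW := weightSeq_pos ω 1 1
  have hu : (weightSeq ω 1 1 + 1) < ((n + 1 : ℕ) : ℝ) * t := by push_cast; linarith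
  have h1 := hω.pow_le_weightSeq le_rfl 1 (u := ((n + 1 : ℕ) : ℝ) * t) (by linarith)
  have h2 := hω.map_nat_mul_le n ht.le
  rw [← h0, mul_zero] at h2
  have h3 : ω (((n + 1 : ℕ) : ℝ) * t) = 0 := le_antisymm h2 (hω.nonneg _ (by positivity))
  rw [h3] at h1
  simp only [pow_one, mul_zero, Real.exp_zero, one_mul] at h1
  linarith

lemma IsWeightFunction.exists_pow_le {ω : ℝ → ℝ} (hω : IsWeightFunction ω) {ℓ : ℕ} (hℓ : 1 ≤ ℓ)
    {A K : ℝ} (hA : 0 < A) (hK : 1 ≤ K) :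
    ∃ m > 0, ∀ j : ℕ, 1 ≤ j → ∀ y : ℝ, 0 ≤ y →
      K * (A * y) ^ j ≤ Real.exp (m * ω y) * weightSeq ω ℓ j := by
  set b : ℝ := Real.exp (-(ℓ * ω 1)) / K with hb
  have hK0 : 0 < K := by linarith
  have hb0 : 0 < b := by positivity
  have hω1 := hω.nonneg 1 zero_le_one
  have hb1 : b ≤ 1 := by
    rw [hb, div_le_one hK0]
    exact (Real.exp_le_one_iff.2 (neg_nonpos.2 (by positivity))).trans hK
  have hδ : 0 < ω (b / A) := hω.pos (by positivity)
  set δ := ω (b / A) with hδd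
  obtain ⟨N, hN⟩ := exists_nat_gt A
  have hlog : 0 ≤ Real.log K := Real.log_nonneg hK
  refine ⟨Real.log K / δ + ℓ * (ω 1 / δ + (N + 1 : ℕ)), by positivity, fun j hj y hy => ?_⟩
  have hωy := hω.nonneg y hy
  have hW := weightSeq_pos ω ℓ j
  rcases le_or_gt (A * y) b with hc | hc
  · have h1 : (A * y) ^ j ≤ b := by
      calc (A * y) ^ j ≤ (A * y) ^ 1 :=
            pow_le_pow_of_le_one (by positivity) (hc.trans hb1) hj
        _ ≤ b := by simpa using hc
    have h2 : K * b ≤ weightSeq ω ℓ j := by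
      have := hω.pow_le_weightSeq hℓ j (le_refl 1)
      rw [one_pow] at this
      rw [hb, mul_div_cancel₀ _ hK0.ne', Real.exp_neg, inv_le_iff_one_le_mul₀ (Real.exp_pos _)]
      linarith
    have h3 : 1 ≤ Real.exp ((Real.log K / δ + ℓ * (ω 1 / δ + (N + 1 : ℕ))) * ω y) :=
      Real.one_le_exp (by positivity)
    nlinarith
  · have hδy : δ ≤ ω y := by
      refine hω.monotone (Set.mem_Ici.2 (by positivity)) (Set.mem_Ici.2 hy) ?_
      rw [div_le_iff₀ hA]
      linarith
    have hδ1 : 1 ≤ ω y / δ := (one_le_div hδ).2 hδy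
    set s := 1 + A * y with hs
    have h1 : (A * y) ^ j ≤ s ^ j := pow_le_pow_left₀ (by positivity) (by linarith) _
    have h2 := hω.pow_le_weightSeq hℓ j (u := s) (by have : 0 ≤ A * y := by positivity
                                                     linarith)
    have h3 : ω s ≤ (ω 1 / δ + (N + 1 : ℕ)) * ω y := by
      have a1 := hω.subadditive 1 (A * y) zero_le_one (by positivity)
      have a2 : ω (A * y) ≤ ω (((N + 1 : ℕ) : ℝ) * y) := by
        refine hω.monotone (Set.mem_Ici.2 (by positivity)) (Set.mem_Ici.2 (by positivity)) ?_
        gcongr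
        push_cast
        linarith
      have a3 := hω.map_nat_mul_le N hy
      have a4 : ω 1 ≤ ω 1 / δ * ω y := by
        rw [div_mul_eq_mul_div, mul_div_assoc]
        exact le_mul_of_one_le_right hω1 hδ1
      rw [add_mul]
      linarith
    have h4 : Real.log K ≤ Real.log K / δ * ω y := by
      rw [div_mul_eq_mul_div, mul_div_assoc]
      exact le_mul_of_one_le_right hlog hδ1
    calc K * (A * y) ^ j ≤ Real.exp (Real.log K) * (Real.exp (ℓ * ω s) * weightSeq ω ℓ j) := by
          rw [Real.exp_log hK0]
          exact mul_le_mul_of_nonneg_left (h1.trans h2) hK0.le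
      _ = Real.exp (Real.log K + ℓ * ω s) * weightSeq ω ℓ j := by rw [Real.exp_add]; ring
      _ ≤ _ := by
          have : (ℓ : ℝ) * ω s ≤ ℓ * ((ω 1 / δ + (N + 1 : ℕ)) * ω y) := by gcongr
          gcongr
          linarith

lemma Nat.sum_antidiagonal_multichoose (j l : ℕ) :
    ∑ q ∈ Finset.HasAntidiagonal.antidiagonal l, Nat.multichoose j q.2 = Nat.multichoose (j + 1) l := by
  induction l with
  | zero => simp
  | succ l ih =>
    rw [Finset.Nat.sum_antidiagonal_succ, Nat.multichoose_succ_succ, ih]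

/-- A Grönwall-type estimate for the recursion satisfied by the Taylor coefficients of an
exponential. -/
lemma le_sum_antidiagonal_multichoose {w p : ℕ → ℝ} {Y K : ℝ} (hw : ∀ k, 0 ≤ w k)
    (hww : ∀ j k, w j * w k ≤ w (j + k)) (hY : 0 ≤ Y) (hK : 0 ≤ K) (h0 : p 0 ≤ K * w 0)
    (hp : ∀ n : ℕ, ((n : ℝ) + 1) * p (n + 1) ≤ Y * ∑ q ∈ Finset.HasAntidiagonal.antidiagonal n, w q.1 * p q.2)
    (n : ℕ) :
    p n ≤ K * ∑ q ∈ Finset.HasAntidiagonal.antidiagonal n,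
      Y ^ q.1 / (q.1.factorial : ℝ) * (Nat.multichoose q.1 q.2 : ℝ) * w q.2 := by
  induction n using Nat.strong_induction_on with
  | _ n ih =>
  cases n with
  | zero => simpa using h0
  | succ n =>
    have hn : (0 : ℝ) < (n : ℝ) + 1 := by positivity
    refine le_of_mul_le_mul_left ((hp n).trans ?_) hn
    rw [Finset.Nat.sum_antidiagonal_succ]
    simp only [Nat.multichoose_zero_succ, Nat.cast_zero, mul_zero, zero_mul, zero_add]
    calc Y * ∑ q ∈ Finset.HasAntidiagonal.antidiagonal n, w q.1 * p q.2
        ≤ Y * ∑ q ∈ Finset.HasAntidiagonal.antidiagonal n, w q.1 * (K * ∑ r ∈ Finset.HasAntidiagonal.antidiagonal q.2,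
            Y ^ r.1 / (r.1.factorial : ℝ) * (Nat.multichoose r.1 r.2 : ℝ) * w r.2) := by
          gcongr with q hq
          · exact hw _
          · exact ih _ (by have := Finset.HasAntidiagonal.mem_antidiagonal.1 hq; omega)
      _ = K * ∑ q ∈ Finset.HasAntidiagonal.antidiagonal n, ∑ r ∈ Finset.HasAntidiagonal.antidiagonal q.2,
            Y ^ (r.1 + 1) / (r.1.factorial : ℝ) * (Nat.multichoose r.1 r.2 : ℝ) *
              (w q.1 * w r.2) := by
          simp only [Finset.mul_sum]
          refine Finset.sum_congr rfl fun q _ => Finset.sum_congr rfl fun r _ => ?_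
          ring
      _ ≤ K * ∑ q ∈ Finset.HasAntidiagonal.antidiagonal n, ∑ r ∈ Finset.HasAntidiagonal.antidiagonal q.2,
            Y ^ (r.1 + 1) / (r.1.factorial : ℝ) * (Nat.multichoose r.1 r.2 : ℝ) *
              w (q.1 + r.2) := by
          gcongr
          exact hww _ _
      _ = K * ∑ q ∈ Finset.HasAntidiagonal.antidiagonal n, ∑ r ∈ Finset.HasAntidiagonal.antidiagonal q.2,
            Y ^ (q.1 + 1) / (q.1.factorial : ℝ) * (Nat.multichoose q.1 r.2 : ℝ) *
              w q.2 := by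
          congr 1
          rw [Finset.sum_sigma', Finset.sum_sigma']
          refine Finset.sum_nbij' (fun x => ⟨(x.2.1, x.1.1 + x.2.2), (x.1.1, x.2.2)⟩)
            (fun x => ⟨(x.2.1, x.1.1 + x.2.2), (x.1.1, x.2.2)⟩) ?_ ?_ ?_ ?_ ?_
          · rintro ⟨⟨a, b⟩, ⟨c, d⟩⟩ h
            simp only [Finset.mem_sigma, Finset.HasAntidiagonal.mem_antidiagonal] at h ⊢
            exact ⟨by change c + (a + d) = n; omega, trivial⟩
          · rintro ⟨⟨a, b⟩, ⟨c, d⟩⟩ h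
            simp only [Finset.mem_sigma, Finset.HasAntidiagonal.mem_antidiagonal] at h ⊢
            exact ⟨by change c + (a + d) = n; omega, trivial⟩
          · rintro ⟨⟨a, b⟩, ⟨c, d⟩⟩ h
            simp only [Finset.mem_sigma, Finset.HasAntidiagonal.mem_antidiagonal] at h
            obtain ⟨_, rfl⟩ := h
            rfl
          · rintro ⟨⟨a, b⟩, ⟨c, d⟩⟩ h
            simp only [Finset.mem_sigma, Finset.HasAntidiagonal.mem_antidiagonal] at h
            obtain ⟨_, rfl⟩ := h
            rfl
          · rintro ⟨⟨a, b⟩, ⟨c, d⟩⟩ _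
            rfl
      _ = K * ∑ q ∈ Finset.HasAntidiagonal.antidiagonal n,
            Y ^ (q.1 + 1) / (q.1.factorial : ℝ) * (Nat.multichoose (q.1 + 1) q.2 : ℝ) *
              w q.2 := by
          congr 1
          refine Finset.sum_congr rfl fun q _ => ?_
          rw [← Nat.sum_antidiagonal_multichoose q.1 q.2, ← Finset.sum_mul, ← Finset.mul_sum]
          push_cast
          rfl
      _ ≤ K * (((n : ℝ) + 1) * ∑ q ∈ Finset.HasAntidiagonal.antidiagonal n,
            Y ^ (q.1 + 1) / ((q.1 + 1).factorial : ℝ) * (Nat.multichoose (q.1 + 1) q.2 : ℝ) *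
              w q.2) := by
          rw [Finset.mul_sum (Finset.HasAntidiagonal.antidiagonal n) _ ((n : ℝ) + 1)]
          refine mul_le_mul_of_nonneg_left (Finset.sum_le_sum fun q hq => ?_) hK
          rw [← mul_assoc, ← mul_assoc]
          have := hw q.2
          gcongr
          have hq : (q.1 : ℝ) ≤ n := by
            have := Finset.HasAntidiagonal.mem_antidiagonal.1 hq
            exact_mod_cast (by omega : q.1 ≤ n)
          rw [Nat.factorial_succ, mul_div_assoc', div_le_div_iff₀ (by positivity) (by positivity)]
          push_cast
          have : 0 ≤ Y ^ (q.1 + 1) * (q.1.factorial : ℝ) := by positivity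
          nlinarith
      _ = _ := by ring

lemma Nat.multichoose_le_two_pow (j k : ℕ) : Nat.multichoose j k ≤ 2 ^ (j + k) := by
  rw [Nat.multichoose_eq]
  exact (Nat.choose_le_two_pow _ _).trans (Nat.pow_le_pow_right (by norm_num) (by omega))

lemma iteratedDeriv_ofReal_comp {f : ℝ → ℝ} (hf : ContDiff ℝ (⊤ : ℕ∞) f) (n : ℕ) :
    iteratedDeriv n (fun u => (f u : ℂ)) = fun u => ((iteratedDeriv n f u : ℝ) : ℂ) := by
  induction n with
  | zero => simp
  | succ n ih =>
    rw [iteratedDeriv_succ, ih]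
    funext u
    have hd : DifferentiableAt ℝ (iteratedDeriv n f) u :=
      (hf.differentiable_iteratedDeriv n (by exact_mod_cast ENat.natCast_lt_top n)) u
    rw [iteratedDeriv_succ]
    exact hd.hasDerivAt.ofReal_comp.deriv

lemma iteratedDeriv_succ_cexp_ofReal_mul {φ : ℝ → ℝ} (hφ : ContDiff ℝ (⊤ : ℕ∞) φ) (y x : ℝ)
    (n : ℕ) :
    iteratedDeriv (n + 1) (fun u : ℝ => Complex.exp (Complex.I * ((φ u * y : ℝ) : ℂ))) x =
      Complex.I * y * ∑ k ∈ Finset.range (n + 1), (n.choose k : ℂ) *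
        ((iteratedDeriv (k + 1) φ x : ℝ) : ℂ) *
        iteratedDeriv (n - k) (fun u : ℝ => Complex.exp (Complex.I * ((φ u * y : ℝ) : ℂ))) x := by
  set σ : ℝ → ℂ := fun u : ℝ => Complex.exp (Complex.I * ((φ u * y : ℝ) : ℂ)) with hσ
  have hφ1 : ContDiff ℝ (⊤ : ℕ∞) (deriv φ) := (contDiff_infty_iff_deriv.1 hφ).2
  have hσc : ContDiff ℝ (⊤ : ℕ∞) σ :=
    Complex.contDiff_exp.comp (contDiff_const.mul
      (Complex.ofRealCLM.contDiff.comp (hφ.mul contDiff_const)))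
  have hφc : ContDiff ℝ (⊤ : ℕ∞) (fun u => ((deriv φ u : ℝ) : ℂ)) :=
    Complex.ofRealCLM.contDiff.comp hφ1
  have hd : deriv σ = fun u => Complex.I * y * (((deriv φ u : ℝ) : ℂ) * σ u) := by
    funext u
    have h1 : HasDerivAt φ (deriv φ u) u := ((contDiff_infty_iff_deriv.1 hφ).1 u).hasDerivAt
    have h2 := ((h1.mul_const y).ofReal_comp.const_mul Complex.I).cexp
    rw [h2.deriv, hσ]
    push_cast
    ring
  have hle : ((n : ℕ∞) : WithTop ℕ∞) ≤ ((⊤ : ℕ∞) : WithTop ℕ∞) := by exact_mod_cast le_top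
  rw [iteratedDeriv_succ', hd, iteratedDeriv_const_mul_field]
  congr 1
  rw [iteratedDeriv_fun_mul (hφc.of_le hle).contDiffAt (hσc.of_le hle).contDiffAt]
  refine Finset.sum_congr rfl fun k _ => ?_
  rw [iteratedDeriv_ofReal_comp hφ1, iteratedDeriv_succ']

lemma norm_iteratedDeriv_succ_cexp_le {φ : ℝ → ℝ} (hφ : ContDiff ℝ (⊤ : ℕ∞) φ) {A : ℝ}
    {W : ℕ → ℝ} (hW : ∀ k x, |iteratedDeriv (k + 1) φ x| ≤ A * W k) (x y : ℝ) (n : ℕ) :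
    ‖iteratedDeriv (n + 1) (fun u : ℝ => Complex.exp (Complex.I * ((φ u * y : ℝ) : ℂ))) x‖ ≤
      A * |y| * ∑ k ∈ Finset.range (n + 1), (n.choose k : ℝ) * W k *
        ‖iteratedDeriv (n - k)
          (fun u : ℝ => Complex.exp (Complex.I * ((φ u * y : ℝ) : ℂ))) x‖ := by
  rw [iteratedDeriv_succ_cexp_ofReal_mul hφ, norm_mul, norm_mul, Complex.norm_I, one_mul,
    Complex.norm_real, Real.norm_eq_abs, mul_comm A, mul_assoc]
  gcongr
  refine (norm_sum_le _ _).trans ?_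
  rw [Finset.mul_sum]
  gcongr with k _
  rw [norm_mul, norm_mul, Complex.norm_natCast, Complex.norm_real, Real.norm_eq_abs]
  calc _ ≤ (n.choose k : ℝ) * (A * W k) * _ := by gcongr; exact hW k x
    _ = _ := by ring

/-- if `φ' ∈ B_{L∞,ω}(ℝ)` and `σ(x,y) = e^{iφ(x)y}`, then for every
`ℓ ∈ ℕ` there is `m_ℓ > 0` with
`|∂_x^n σ(x,y)| ≤ 4^n e^{m_ℓ ω(|y|)} e^{ℓφ*(n/ℓ)}` for all `n ≥ 1`. -/
theorem stmt9 (ω : ℝ → ℝ) (hω : IsWeightFunction ω)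
    (φ : ℝ → ℝ) (hφ : ContDiff ℝ (⊤ : ℕ∞) φ)
    (hφ' : ∀ ℓ : ℕ, 1 ≤ ℓ → ∃ A > 0, ∀ k : ℕ, 1 ≤ k → ∀ x : ℝ,
      |iteratedDeriv k φ x| ≤ A * Real.exp ((ℓ : ℝ) * youngConj ω ((k : ℝ) / ℓ)))
    (ℓ : ℕ) (hℓ : 1 ≤ ℓ) :
    ∃ mℓ > 0, ∀ n : ℕ, 1 ≤ n → ∀ x y : ℝ,
      ‖iteratedDeriv n (fun u : ℝ => Complex.exp (Complex.I * ((φ u * y : ℝ) : ℂ))) x‖ ≤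
        4 ^ n * Real.exp (mℓ * ω |y|) * Real.exp ((ℓ : ℝ) * youngConj ω ((n : ℝ) / ℓ)) := by
  obtain ⟨A₀, hA₀, hA⟩ := hφ' (ℓ + 1) (by omega)
  have hW := weightSeq_pos ω ℓ
  set A := A₀ * weightSeq ω 1 1 with hAd
  have hApos : 0 < A := mul_pos hA₀ (weightSeq_pos _ _ _)
  have hder : ∀ k x, |iteratedDeriv (k + 1) φ x| ≤ A * weightSeq ω ℓ k := fun k x => by
    refine (hA (k + 1) (by omega) x).trans ?_
    rw [hAd, mul_assoc]
    exact mul_le_mul_of_nonneg_left (hω.weightSeq_succ_le hℓ k) hA₀.le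
  set K := 1 + (weightSeq ω ℓ 0)⁻¹ with hKd
  have hK : 1 ≤ K := le_add_of_nonneg_right (inv_nonneg.2 (hW 0).le)
  obtain ⟨m, hm, hmb⟩ := hω.exists_pow_le hℓ hApos hK
  refine ⟨m, hm, fun n hn x y => ?_⟩
  set σ : ℝ → ℂ := fun u : ℝ => Complex.exp (Complex.I * ((φ u * y : ℝ) : ℂ)) with hσ
  have hww : ∀ j k : ℕ, weightSeq ω ℓ j / (j.factorial : ℝ) *
      (weightSeq ω ℓ k / (k.factorial : ℝ)) ≤
        weightSeq ω ℓ (j + k) / ((j + k).factorial : ℝ) := fun j k => by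
    have h := hω.choose_mul_weightSeq_mul_le hℓ j k
    rw [Nat.cast_add_choose, div_mul_eq_mul_div, div_le_iff₀ (by positivity)] at h
    rw [div_mul_div_comm, div_le_div_iff₀ (by positivity) (by positivity)]
    linarith
  have hp := le_sum_antidiagonal_multichoose
    (w := fun k => weightSeq ω ℓ k / (k.factorial : ℝ))
    (p := fun n => ‖iteratedDeriv n σ x‖ / (n.factorial : ℝ)) (Y := A * |y|) (K := K)
    (fun k => div_nonneg (hW k).le (by positivity)) hww (by positivity) (by linarith)
    (by
      have h1 : ‖σ x‖ = 1 := by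
        rw [hσ]; dsimp only; rw [mul_comm]; exact Complex.norm_exp_ofReal_mul_I _
      simp only [iteratedDeriv_zero, h1, Nat.factorial_zero, Nat.cast_one, div_one]
      rw [hKd, add_mul, inv_mul_cancel₀ (hW 0).ne']
      linarith [hW 0])
    (fun n => by
      have h := norm_iteratedDeriv_succ_cexp_le hφ hder x y n
      rw [Finset.Nat.sum_antidiagonal_eq_sum_range_succ
        (fun a b => weightSeq ω ℓ a / (a.factorial : ℝ) *
          (‖iteratedDeriv b σ x‖ / (b.factorial : ℝ)))]
      have e : ((n : ℝ) + 1) * (‖iteratedDeriv (n + 1) σ x‖ / ((n + 1).factorial : ℝ)) =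
          ‖iteratedDeriv (n + 1) σ x‖ / (n.factorial : ℝ) := by
        rw [Nat.factorial_succ]; push_cast; field_simp
      rw [e, div_le_iff₀ (by positivity), mul_assoc, Finset.sum_mul]
      refine h.trans (le_of_eq ?_)
      congr 1
      refine Finset.sum_congr rfl fun k hk => ?_
      rw [Nat.cast_choose ℝ (Nat.lt_succ_iff.1 (Finset.mem_range.1 hk))]
      field_simp
      rfl) n
  have hterm : ∀ q ∈ Finset.HasAntidiagonal.antidiagonal n,
      K * ((A * |y|) ^ q.1 / (q.1.factorial : ℝ) * (Nat.multichoose q.1 q.2 : ℝ) *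
        (weightSeq ω ℓ q.2 / (q.2.factorial : ℝ))) ≤
      2 ^ n * (Real.exp (m * ω |y|) * (weightSeq ω ℓ n / (n.factorial : ℝ))) := by
    rintro ⟨j, k⟩ hq
    have hjk : j + k = n := Finset.HasAntidiagonal.mem_antidiagonal.1 hq
    subst hjk
    have hWk := hW k
    have hWjk := hW (j + k)
    dsimp only
    rcases Nat.eq_zero_or_pos j with rfl | hj
    · obtain ⟨k, rfl⟩ := Nat.exists_eq_add_of_le' (show 1 ≤ k by omega)
      rw [Nat.multichoose_zero_succ]
      simp only [Nat.cast_zero, mul_zero, zero_mul]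
      positivity
    · have hmc : (Nat.multichoose j k : ℝ) ≤ 2 ^ (j + k) := by
        exact_mod_cast Nat.multichoose_le_two_pow j k
      calc _ = (Nat.multichoose j k : ℝ) * ((K * (A * |y|) ^ j) / (j.factorial : ℝ) *
            (weightSeq ω ℓ k / (k.factorial : ℝ))) := by ring
        _ ≤ 2 ^ (j + k) * ((Real.exp (m * ω |y|) * weightSeq ω ℓ j) / (j.factorial : ℝ) *
            (weightSeq ω ℓ k / (k.factorial : ℝ))) := by
          have := hmb j hj |y| (abs_nonneg y)
          gcongr
        _ = 2 ^ (j + k) * (Real.exp (m * ω |y|) * (weightSeq ω ℓ j / (j.factorial : ℝ) *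
            (weightSeq ω ℓ k / (k.factorial : ℝ)))) := by ring
        _ ≤ _ := by
          have := hww j k
          gcongr
  rw [Finset.mul_sum] at hp
  have hp2 := hp.trans (Finset.sum_le_card_nsmul _ _ _ hterm)
  rw [Finset.Nat.card_antidiagonal, nsmul_eq_mul, div_le_iff₀ (by positivity)] at hp2
  have hn2 : ((n + 1 : ℕ) : ℝ) ≤ 2 ^ n := by exact_mod_cast Nat.lt_two_pow_self
  have hWn := hW n
  calc _ ≤ _ := hp2
    _ = ((n + 1 : ℕ) : ℝ) * (2 ^ n * (Real.exp (m * ω |y|) * weightSeq ω ℓ n)) := by field_simp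
    _ ≤ 2 ^ n * (2 ^ n * (Real.exp (m * ω |y|) * weightSeq ω ℓ n)) := by gcongr
    _ = _ := by
      rw [show (4 : ℝ) = 2 * 2 by norm_num, mul_pow, weightSeq]
      ring
end

section
/- Let ω be a subadditive weight function with Young conjugate φ*_ω. Let φ:ℝ→ℝ be a smooth function with φ′ ∈ B_{L∞,ω}(ℝ), and set σ(x,y) = exp(i φ(x)y). Let g be a nonzero smooth function supported in [−1,1] belonging to D_ω. Then for every N ∈ ℕ there exist k ∈ ℕ and C > 0 such that |V_{g⊗g}σ(z,ζ)| ≤ C · e^{−N·ω(|ζ₁|) + k·ω(|z₂|)} for all z = (z₁,z₂), ζ = (ζ₁,ζ₂) ∈ ℝ²; that is, σ ∈ M^∞_m(ℝ²) with m(z,ζ) = e^{N·ω(|ζ₁|) − k·ω(|z₂|)}. -/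
open MeasureTheory

/-- The moment `sup_{t ≥ 1} tⁿ e^{-p ω(t)} = e^{p φ*_ω(n / p)}` of a weight function `ω`. -/
noncomputable def weightMoment (ω : ℝ → ℝ) (p n : ℕ) : ℝ :=
  Real.exp ((p : ℝ) * youngConj ω ((n : ℝ) / p))

lemma weightMoment_pos (ω : ℝ → ℝ) (p n : ℕ) : 0 < weightMoment ω p n := Real.exp_pos _

namespace IsWeightFunction

variable {ω : ℝ → ℝ}

lemma exists_mul_log_le (hω : IsWeightFunction ω) (s : ℝ) :
    ∃ T : ℝ, 1 ≤ T ∧ ∀ t, T ≤ t → s * Real.log t ≤ ω t := by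
  have hc : 0 < (|s| + 1)⁻¹ := by positivity
  obtain ⟨T, hT⟩ := Filter.eventually_atTop.1 (hω.growth.bound hc)
  refine ⟨max T 1, le_max_right _ _, fun t ht => ?_⟩
  have ht1 : 1 ≤ t := (le_max_right _ _).trans ht
  have h := hT t ((le_max_left _ _).trans ht)
  have hlog : 0 ≤ Real.log t := Real.log_nonneg ht1
  have hle : Real.log t ≤ Real.log (1 + t ^ 2) :=
    Real.log_le_log (by linarith) (by nlinarith)
  rw [Real.norm_of_nonneg (hlog.trans hle), Real.norm_of_nonneg (hω.nonneg t (by linarith)),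
    le_inv_mul_iff₀ (by positivity)] at h
  have hs := le_abs_self s
  have hs' := abs_nonneg s
  nlinarith

lemma bddAbove_youngConj (hω : IsWeightFunction ω) (s : ℝ) :
    BddAbove ((fun t : ℝ => s * t - ω (Real.exp t)) '' Set.Ici 0) := by
  obtain ⟨T, hT1, hT⟩ := hω.exists_mul_log_le s
  refine ⟨|s| * Real.log T, ?_⟩
  rintro _ ⟨t, ht, rfl⟩
  simp only [Set.mem_Ici] at ht
  have hlogT : 0 ≤ Real.log T := Real.log_nonneg hT1
  rcases le_total T (Real.exp t) with h | h
  · have := hT _ h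
    rw [Real.log_exp] at this
    have h0 : 0 ≤ |s| * Real.log T := by positivity
    dsimp only
    linarith
  · have htT : t ≤ Real.log T := (Real.le_log_iff_exp_le (by linarith)).2 h
    have h0 := hω.nonneg (Real.exp t) (Real.exp_pos t).le
    have h1 : s * t ≤ |s| * t := mul_le_mul_of_nonneg_right (le_abs_self s) ht
    have h2 : |s| * t ≤ |s| * Real.log T := mul_le_mul_of_nonneg_left htT (abs_nonneg s)
    dsimp only
    linarith

lemma pow_mul_exp_le_weightMoment (hω : IsWeightFunction ω) {p : ℕ} (hp : 1 ≤ p) (n : ℕ)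
    {t : ℝ} (ht : 1 ≤ t) :
    t ^ n * Real.exp (-(p * ω t)) ≤ weightMoment ω p n := by
  have hp0 : (0 : ℝ) < p := by exact_mod_cast hp
  have ht0 : 0 < t := by linarith
  have h := le_csSup (hω.bddAbove_youngConj ((n : ℝ) / p))
    (Set.mem_image_of_mem _ (Set.mem_Ici.2 (Real.log_nonneg ht)))
  have h' := mul_le_mul_of_nonneg_left h hp0.le
  rw [weightMoment, ← Real.exp_log (pow_pos ht0 n), ← Real.exp_add, Real.exp_le_exp, Real.log_pow]
  refine le_trans (le_of_eq ?_) h'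
  simp only [Real.exp_log ht0]
  field_simp
  ring

lemma weightMoment_le {p : ℕ} (hp : 1 ≤ p) (n : ℕ) {B : ℝ} (hB : 0 < B)
    (h : ∀ t : ℝ, 1 ≤ t → t ^ n * Real.exp (-(p * ω t)) ≤ B) :
    weightMoment ω p n ≤ B := by
  have hp0 : (0 : ℝ) < p := by exact_mod_cast hp
  rw [weightMoment, ← Real.le_log_iff_exp_le hB, ← le_div_iff₀' hp0]
  refine csSup_le (Set.nonempty_Ici.image _) ?_
  rintro _ ⟨t, ht, rfl⟩
  have h1 := h (Real.exp t) (Real.one_le_exp ht)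
  rw [← Real.exp_nat_mul, ← Real.exp_add, ← Real.le_log_iff_exp_le hB] at h1
  rw [le_div_iff₀' hp0]
  refine le_trans (le_of_eq ?_) h1
  field_simp
  ring

/-- Subadditivity of `ω` makes `n ↦ weightMoment ω p n / n!` supermultiplicative. -/
lemma choose_mul_weightMoment_le (hω : IsWeightFunction ω) {p : ℕ} (hp : 1 ≤ p) (j k : ℕ) :
    ((j + k).choose j : ℝ) * (weightMoment ω p j * weightMoment ω p k) ≤
      weightMoment ω p (j + k) := by
  set M := weightMoment ω p (j + k)
  have hM : 0 < M := weightMoment_pos _ _ _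
  have hc : (0 : ℝ) < (j + k).choose j := by exact_mod_cast Nat.choose_pos (Nat.le_add_right j k)
  have hk := weightMoment_pos ω p k
  have key : ∀ s t : ℝ, 1 ≤ s → 1 ≤ t → ((j + k).choose j : ℝ) *
      ((s ^ j * Real.exp (-(p * ω s))) * (t ^ k * Real.exp (-(p * ω t)))) ≤ M := by
    intro s t hs ht
    have h1 : s ^ j * t ^ k * ((j + k).choose j : ℝ) ≤ (s + t) ^ (j + k) := by
      rw [add_pow]
      have := Finset.single_le_sum (s := Finset.range (j + k + 1))
        (f := fun m => s ^ m * t ^ (j + k - m) * ((j + k).choose m : ℝ))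
        (fun m _ => by positivity) (Finset.mem_range.2 (by omega : j < j + k + 1))
      simpa using this
    have h2 : Real.exp (-(p * ω s)) * Real.exp (-(p * ω t)) ≤ Real.exp (-(p * ω (s + t))) := by
      rw [← Real.exp_add, Real.exp_le_exp]
      have := mul_le_mul_of_nonneg_left (hω.subadditive s t (by linarith) (by linarith))
        (Nat.cast_nonneg (α := ℝ) p)
      linarith
    calc _ = (s ^ j * t ^ k * ((j + k).choose j : ℝ)) *
          (Real.exp (-(p * ω s)) * Real.exp (-(p * ω t))) := by ring
      _ ≤ (s + t) ^ (j + k) * Real.exp (-(p * ω (s + t))) := by gcongr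
      _ ≤ M := hω.pow_mul_exp_le_weightMoment hp _ (by linarith)
  have h1 : ∀ s : ℝ, 1 ≤ s → ((j + k).choose j : ℝ) * (s ^ j * Real.exp (-(p * ω s))) *
      weightMoment ω p k ≤ M := by
    intro s hs
    have hpos : 0 < ((j + k).choose j : ℝ) * (s ^ j * Real.exp (-(p * ω s))) := by positivity
    rw [← le_div_iff₀' hpos]
    refine weightMoment_le hp k (by positivity) fun t ht => ?_
    rw [le_div_iff₀' hpos]
    refine le_trans (le_of_eq ?_) (key s t hs ht)
    ring
  have h2 : weightMoment ω p j ≤ M / (((j + k).choose j : ℝ) * weightMoment ω p k) := by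
    refine weightMoment_le hp j (by positivity) fun s hs => ?_
    rw [le_div_iff₀' (by positivity)]
    refine le_trans (le_of_eq ?_) (h1 s hs)
    ring
  rw [le_div_iff₀' (by positivity)] at h2
  refine le_trans (le_of_eq ?_) h2
  ring

lemma exists_le_mul_exp (hω : IsWeightFunction ω) :
    ∃ D : ℝ, 1 ≤ D ∧ ∀ t, 1 ≤ t → t ≤ D * Real.exp (ω t) := by
  obtain ⟨T, hT1, hT⟩ := hω.exists_mul_log_le 1
  refine ⟨T, hT1, fun t ht => ?_⟩
  have h1 : 1 ≤ Real.exp (ω t) := Real.one_le_exp (hω.nonneg t (by linarith))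
  rcases le_total T t with h | h
  · have h2 := hT t h
    rw [one_mul, Real.log_le_iff_le_exp (by linarith)] at h2
    nlinarith
  · nlinarith

lemma exists_weightMoment_succ_le (hω : IsWeightFunction ω) :
    ∃ D : ℝ, 1 ≤ D ∧ ∀ p : ℕ, 1 ≤ p → ∀ n : ℕ,
      weightMoment ω (p + 1) (n + 1) ≤ D * weightMoment ω p n := by
  obtain ⟨D, hD1, hD⟩ := hω.exists_le_mul_exp
  refine ⟨D, hD1, fun p hp n => weightMoment_le (by omega) _
    (mul_pos (by linarith) (weightMoment_pos _ _ _)) fun t ht => ?_⟩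
  have h1 : t * Real.exp (-ω t) ≤ D := by
    rw [Real.exp_neg, ← div_eq_mul_inv, div_le_iff₀ (Real.exp_pos _)]
    exact hD t ht
  calc t ^ (n + 1) * Real.exp (-((p + 1 : ℕ) * ω t))
      = (t * Real.exp (-ω t)) * (t ^ n * Real.exp (-(p * ω t))) := by
        have : -(((p + 1 : ℕ) : ℝ) * ω t) = -ω t + -(p * ω t) := by push_cast; ring
        rw [this, Real.exp_add]
        ring
    _ ≤ D * weightMoment ω p n := by
        have := hω.pow_mul_exp_le_weightMoment hp n ht
        gcongr

/-- Powers of `Y` are dominated by the moments, up to a factor independent of the exponent. -/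
lemma pow_le_weightMoment_mul_exp (hω : IsWeightFunction ω) {p : ℕ} (hp : 1 ≤ p) (n : ℕ)
    {Y : ℝ} (hY : 0 ≤ Y) :
    Y ^ n ≤ weightMoment ω p n * Real.exp (p * ω 1 + p * ω Y) := by
  have h1 := hω.nonneg 1 zero_le_one
  have h2 := hω.nonneg Y hY
  have hM := weightMoment_pos ω p n
  have aux : ∀ t : ℝ, 1 ≤ t → t ^ n ≤ weightMoment ω p n * Real.exp (p * ω t) := by
    intro t ht
    have h := hω.pow_mul_exp_le_weightMoment hp n ht
    rwa [Real.exp_neg, ← div_eq_mul_inv, div_le_iff₀ (Real.exp_pos _)] at h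
  rcases le_total 1 Y with h | h
  · refine (aux Y h).trans ?_
    gcongr
    have : 0 ≤ (p : ℝ) * ω 1 := by positivity
    linarith
  · refine (pow_le_one₀ hY h).trans ?_
    have h3 := aux 1 le_rfl
    rw [one_pow] at h3
    refine h3.trans ?_
    gcongr
    have : 0 ≤ (p : ℝ) * ω Y := by positivity
    linarith

lemma apply_nat_mul_le (hω : IsWeightFunction ω) (n : ℕ) {t : ℝ} (ht : 0 ≤ t) :
    ω ((n + 1 : ℕ) * t) ≤ (n + 1 : ℕ) * ω t := by
  induction n with
  | zero => simp
  | succ n ih =>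
    have h := hω.subadditive ((n + 1 : ℕ) * t) t (by positivity) ht
    have e : ((n + 1 + 1 : ℕ) : ℝ) * t = (n + 1 : ℕ) * t + t := by push_cast; ring
    rw [e]
    refine h.trans ?_
    push_cast at ih ⊢
    linarith

/-- Optimising over integer exponents recovers the decay `e^{-p ω}` up to one power. -/
lemma exists_weightMoment_le_pow (hω : IsWeightFunction ω) {p : ℕ} (hp : 1 ≤ p)
    {x : ℝ} (hx : 1 ≤ x) :
    ∃ n : ℕ, weightMoment ω p n ≤ x ^ n * (x * Real.exp (-(p * ω x))) := by
  have hp0 : (0 : ℝ) < p := by exact_mod_cast hp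
  have hx0 : 0 < x := by linarith
  set f : ℝ → ℝ := fun t => ω (Real.exp t) with hf
  set r := Real.log x with hr
  have hr0 : 0 ≤ r := Real.log_nonneg hx
  have hfr : f r = ω x := by simp only [hf, hr, Real.exp_log hx0]
  have hmono : Monotone f := fun a b hab =>
    hω.monotone (Real.exp_pos a).le (Real.exp_pos b).le (Real.exp_le_exp.2 hab)
  obtain ⟨d, hd0, hd⟩ : ∃ d : ℝ, 0 ≤ d ∧ ∀ u, f r + d * (u - r) ≤ f u := by
    have hint : ∀ y : ℝ, y ∈ interior (Set.univ : Set ℝ) := by simp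
    refine ⟨derivWithin f (Set.Ioi r) r, (hmono.monotoneOn _).derivWithin_nonneg, fun u => ?_⟩
    rcases lt_trichotomy u r with h | h | h
    · have h1 := hω.convex.slope_le_leftDeriv_of_mem_interior (Set.mem_univ u) (hint r) h
      have h2 := hω.convex.leftDeriv_le_rightDeriv_of_mem_interior (hint r)
      have h3 := h1.trans h2
      rw [slope_def_field, div_le_iff₀ (by linarith)] at h3
      simp only [hf] at h3 ⊢
      linarith
    · simp [h]
    · have h3 := hω.convex.rightDeriv_le_slope_of_mem_interior (hint r) (Set.mem_univ u) h
      rw [slope_def_field, le_div_iff₀ (by linarith)] at h3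
      simp only [hf] at h3 ⊢
      linarith
  refine ⟨⌊p * d⌋₊, weightMoment_le hp _ (by positivity) fun t ht => ?_⟩
  set n := ⌊p * d⌋₊
  have hn1 : (n : ℝ) ≤ p * d := Nat.floor_le (by positivity)
  have hn2 : p * d < n + 1 := Nat.lt_floor_add_one _
  have ht0 : 0 < t := by linarith
  have hu : 0 ≤ Real.log t := Real.log_nonneg ht
  have hdt := hd (Real.log t)
  simp only [hfr] at hdt
  simp only [hf, Real.exp_log ht0] at hdt
  have hdt' := mul_le_mul_of_nonneg_left hdt hp0.le
  have e1 : t ^ n * Real.exp (-(p * ω t)) = Real.exp (n * Real.log t - p * ω t) := by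
    rw [sub_eq_add_neg, Real.exp_add, Real.exp_nat_mul, Real.exp_log ht0]
  have e2 : x ^ n * (x * Real.exp (-(p * ω x))) = Real.exp (n * r + r - p * ω x) := by
    rw [sub_eq_add_neg, Real.exp_add, Real.exp_add, Real.exp_nat_mul, hr, Real.exp_log hx0]
    ring
  rw [e1, e2, Real.exp_le_exp]
  nlinarith [mul_nonneg (sub_nonneg.2 hn1) hu, mul_nonneg (sub_nonneg.2 hn2.le) hr0]

end IsWeightFunction

lemma sum_range_two_pow_sub_le (n : ℕ) :
    ∑ k ∈ Finset.range (n + 1), (2 : ℝ) ^ (n - k) ≤ 2 ^ (n + 1) := by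
  have h := Finset.sum_range_reflect (fun k => (2 : ℝ) ^ k) (n + 1)
  simp only [Nat.add_sub_cancel] at h
  rw [h, geom_sum_eq (by norm_num)]
  norm_num

lemma norm_iteratedDeriv_ofReal_comp {f : ℝ → ℝ} (hf : ContDiff ℝ (⊤ : ℕ∞) f) (n : ℕ) (x : ℝ) :
    ‖iteratedDeriv n (fun t => (f t : ℂ)) x‖ = |iteratedDeriv n f x| := by
  have h := Complex.ofRealLI.norm_iteratedFDeriv_comp_left (x := x) (i := n) hf.contDiffAt
    (by exact_mod_cast le_top)
  rw [norm_iteratedFDeriv_eq_norm_iteratedDeriv, norm_iteratedFDeriv_eq_norm_iteratedDeriv] at h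
  exact h

lemma norm_iteratedDeriv_conj_comp_sub (g : ℝ → ℂ) (z : ℝ) (n : ℕ) (x : ℝ) :
    ‖iteratedDeriv n (fun t => (starRingEnd ℂ) (g (t - z))) x‖ = ‖iteratedDeriv n g (x - z)‖ := by
  have h := Complex.conjLIE.norm_iteratedFDeriv_comp_left (𝕜 := ℝ) (fun t => g (t - z)) x n
  rw [norm_iteratedFDeriv_eq_norm_iteratedDeriv, norm_iteratedFDeriv_eq_norm_iteratedDeriv,
    iteratedDeriv_comp_sub_const] at h
  exact h

lemma contDiff_cexp_I_mul {φ : ℝ → ℝ} (hφ : ContDiff ℝ (⊤ : ℕ∞) φ) (y : ℝ) :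
    ContDiff ℝ (⊤ : ℕ∞) fun x => Complex.exp (Complex.I * ((φ x * y : ℝ) : ℂ)) :=
  (contDiff_const.mul (Complex.ofRealCLM.contDiff.comp (hφ.mul contDiff_const))).cexp

lemma norm_cexp_I_mul_ofReal (t : ℝ) : ‖Complex.exp (Complex.I * (t : ℂ))‖ = 1 := by
  rw [mul_comm, Complex.norm_exp_ofReal_mul_I]

/-- If the derivatives of `φ` are controlled by a sequence `M` with `M n / n!` supermultiplicative,
then so are those of `e^{iφy}`, with a weight `W` dominating the powers of `A|y|` relative to `M`. -/
lemma pow_mul_norm_iteratedDeriv_cexp_le {M : ℕ → ℝ} (hM0 : ∀ n, 0 < M n)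
    (hM : ∀ j k : ℕ, ((j + k).choose j : ℝ) * (M j * M k) ≤ M (j + k))
    {φ : ℝ → ℝ} (hφ : ContDiff ℝ (⊤ : ℕ∞) φ) {A : ℝ} (hA : 0 ≤ A)
    (hφM : ∀ (k : ℕ) (x : ℝ), |iteratedDeriv (k + 1) φ x| ≤ A * M k)
    {y W : ℝ} (hW0 : 0 ≤ W) (hW : ∀ j : ℕ, (A * |y|) ^ j ≤ M j * W) (n : ℕ) :
    ∀ (j : ℕ) (x : ℝ), (A * |y|) ^ j *
      ‖iteratedDeriv n (fun x => Complex.exp (Complex.I * ((φ x * y : ℝ) : ℂ))) x‖ ≤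
        2 ^ n * M (n + j) * W := by
  set E : ℝ → ℂ := fun x => Complex.exp (Complex.I * ((φ x * y : ℝ) : ℂ)) with hE
  have hEsm : ContDiff ℝ (⊤ : ℕ∞) E := contDiff_cexp_I_mul hφ y
  have hφ1 : ContDiff ℝ (⊤ : ℕ∞) (deriv φ) := by
    have h : ContDiff ℝ ((⊤ : ℕ∞) + 1) φ := by simpa using hφ
    exact (contDiff_succ_iff_deriv.1 h).2.2
  induction n using Nat.strong_induction_on with
  | _ n ih =>
  cases n with
  | zero =>
    intro j x
    simp only [iteratedDeriv_zero, hE, norm_cexp_I_mul_ofReal]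
    simpa using hW j
  | succ n =>
    intro j x
    have hderiv : deriv E = fun x => (Complex.I * (y : ℂ)) * ((deriv φ x : ℝ) : ℂ) * E x := by
      funext x
      have h1 : HasDerivAt φ (deriv φ x) x :=
        ((hφ.differentiable (by simp)) x).hasDerivAt
      have h2 := (((h1.mul_const y).ofReal_comp).const_mul Complex.I).cexp
      rw [hE, h2.deriv]
      push_cast
      ring
    have hψsm : ContDiff ℝ (⊤ : ℕ∞) fun x => (Complex.I * (y : ℂ)) * ((deriv φ x : ℝ) : ℂ) :=
      contDiff_const.mul (Complex.ofRealCLM.contDiff.comp hφ1)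
    have hψ : ∀ k : ℕ,
        ‖iteratedDeriv k (fun x => (Complex.I * (y : ℂ)) * ((deriv φ x : ℝ) : ℂ)) x‖ ≤
          |y| * (A * M k) := by
      intro k
      have h1 : ContDiff ℝ (⊤ : ℕ∞) fun x => ((deriv φ x : ℝ) : ℂ) :=
        Complex.ofRealCLM.contDiff.comp hφ1
      rw [iteratedDeriv_const_mul_field, norm_mul, norm_iteratedDeriv_ofReal_comp hφ1,
        ← iteratedDeriv_succ']
      simp only [norm_mul, Complex.norm_I, one_mul, Complex.norm_real, Real.norm_eq_abs]
      exact mul_le_mul_of_nonneg_left (hφM k x) (abs_nonneg y)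
    have hY : 0 ≤ A * |y| := by positivity
    have hn : ((n : ℕ∞) : WithTop ℕ∞) ≤ ((⊤ : ℕ∞) : WithTop ℕ∞) := by exact_mod_cast le_top
    rw [iteratedDeriv_succ', hderiv, iteratedDeriv_fun_mul (hψsm.contDiffAt.of_le hn)
      (hEsm.contDiffAt.of_le hn)]
    have hterm : ∀ k ∈ Finset.range (n + 1), (A * |y|) ^ j * ‖(n.choose k : ℂ) *
        iteratedDeriv k (fun x => (Complex.I * (y : ℂ)) * ((deriv φ x : ℝ) : ℂ)) x *
          iteratedDeriv (n - k) E x‖ ≤ 2 ^ (n - k) * (M (n + 1 + j) * W) := by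
      intro k hk
      have hkn : k ≤ n := Nat.lt_succ_iff.1 (Finset.mem_range.1 hk)
      have h1 := ih (n - k) (by omega) (j + 1) x
      have h2 := hM k (n - k + (j + 1))
      have e : k + (n - k + (j + 1)) = n + 1 + j := by omega
      rw [e] at h2
      have h3 : (n.choose k : ℝ) ≤ ((n + 1 + j).choose k : ℝ) := by
        exact_mod_cast Nat.choose_le_choose k (by omega)
      have hMk := hM0 k
      have hMk' := hM0 (n - k + (j + 1))
      rw [norm_mul, norm_mul, Complex.norm_natCast]
      calc (A * |y|) ^ j * ((n.choose k : ℝ) * ‖iteratedDeriv k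
              (fun x => (Complex.I * (y : ℂ)) * ((deriv φ x : ℝ) : ℂ)) x‖ *
                ‖iteratedDeriv (n - k) E x‖)
          ≤ (A * |y|) ^ j * ((n.choose k : ℝ) * (|y| * (A * M k)) *
                ‖iteratedDeriv (n - k) E x‖) := by
            have := hψ k
            gcongr
        _ = (n.choose k : ℝ) * M k * ((A * |y|) ^ (j + 1) * ‖iteratedDeriv (n - k) E x‖) := by
            ring
        _ ≤ ((n + 1 + j).choose k : ℝ) * M k * (2 ^ (n - k) * M (n - k + (j + 1)) * W) := by
            gcongr
        _ = 2 ^ (n - k) * ((((n + 1 + j).choose k : ℝ) * (M k * M (n - k + (j + 1)))) * W) := by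
            ring
        _ ≤ 2 ^ (n - k) * (M (n + 1 + j) * W) := by gcongr
    have hMn := hM0 (n + 1 + j)
    calc _ ≤ (A * |y|) ^ j * ∑ k ∈ Finset.range (n + 1), ‖(n.choose k : ℂ) *
          iteratedDeriv k (fun x => (Complex.I * (y : ℂ)) * ((deriv φ x : ℝ) : ℂ)) x *
            iteratedDeriv (n - k) E x‖ := by
          gcongr
          exact norm_sum_le _ _
      _ ≤ ∑ k ∈ Finset.range (n + 1), 2 ^ (n - k) * (M (n + 1 + j) * W) := by
          rw [Finset.mul_sum]
          exact Finset.sum_le_sum hterm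
      _ ≤ 2 ^ (n + 1) * (M (n + 1 + j) * W) := by
          rw [← Finset.sum_mul]
          exact mul_le_mul_of_nonneg_right (sum_range_two_pow_sub_le n) (by positivity)
      _ = _ := by ring

/-- Leibniz bound for a product whose factors are controlled by a sequence `M` with `M n / n!`
supermultiplicative. -/
lemma norm_iteratedDeriv_mul_le_of_supermultiplicative {M : ℕ → ℝ} (hM0 : ∀ n, 0 < M n)
    (hM : ∀ j k : ℕ, ((j + k).choose j : ℝ) * (M j * M k) ≤ M (j + k))
    {u v : ℝ → ℂ} (hu : ContDiff ℝ (⊤ : ℕ∞) u) (hv : ContDiff ℝ (⊤ : ℕ∞) v) {a b : ℝ}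
    (ha : 0 ≤ a) (hb : 0 ≤ b) {x : ℝ} (hua : ∀ n, ‖iteratedDeriv n u x‖ ≤ 2 ^ n * M n * a)
    (hvb : ∀ n, ‖iteratedDeriv n v x‖ ≤ b * M n) (n : ℕ) :
    ‖iteratedDeriv n (fun t => v t * u t) x‖ ≤ 2 ^ (n + 1) * M n * (a * b) := by
  have hn : ((n : ℕ∞) : WithTop ℕ∞) ≤ ((⊤ : ℕ∞) : WithTop ℕ∞) := by exact_mod_cast le_top
  rw [iteratedDeriv_fun_mul (hv.contDiffAt.of_le hn) (hu.contDiffAt.of_le hn)]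
  have hMn := hM0 n
  calc _ ≤ ∑ k ∈ Finset.range (n + 1),
        ‖(n.choose k : ℂ) * iteratedDeriv k v x * iteratedDeriv (n - k) u x‖ := norm_sum_le _ _
    _ ≤ ∑ k ∈ Finset.range (n + 1), 2 ^ (n - k) * (M n * (a * b)) := by
        refine Finset.sum_le_sum fun k hk => ?_
        have hkn : k ≤ n := Nat.lt_succ_iff.1 (Finset.mem_range.1 hk)
        have h2 := hM k (n - k)
        rw [Nat.add_sub_cancel' hkn] at h2
        have hMk := hM0 k
        have hMk' := hM0 (n - k)
        rw [norm_mul, norm_mul, Complex.norm_natCast]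
        calc _ ≤ (n.choose k : ℝ) * (b * M k) * (2 ^ (n - k) * M (n - k) * a) := by
              have := hua (n - k)
              have := hvb k
              gcongr
          _ = 2 ^ (n - k) * (((n.choose k : ℝ) * (M k * M (n - k))) * (a * b)) := by ring
          _ ≤ _ := by gcongr
    _ ≤ 2 ^ (n + 1) * (M n * (a * b)) := by
        rw [← Finset.sum_mul]
        exact mul_le_mul_of_nonneg_right (sum_range_two_pow_sub_le n) (by positivity)
    _ = _ := by ring

/-- Integration by parts: decay of the Fourier integral of a smooth function supported in
`[c - 1, c + 1]` in terms of a bound on its `n`-th derivative. -/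
lemma pow_mul_norm_fourier_le {f : ℝ → ℂ} (hf : ContDiff ℝ (⊤ : ℕ∞) f) {c : ℝ}
    (hsupp : tsupport f ⊆ Set.Icc (c - 1) (c + 1)) {n : ℕ} {B : ℝ}
    (hB : ∀ x, ‖iteratedDeriv n f x‖ ≤ B) (ξ : ℝ) :
    (2 * Real.pi * |ξ|) ^ n * ‖FourierTransform.fourier f ξ‖ ≤ 2 * B := by
  have hcs : HasCompactSupport f := isCompact_Icc.of_isClosed_subset (isClosed_tsupport f) hsupp
  have hsub : ∀ k, Function.support (iteratedDeriv k f) ⊆ tsupport f := by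
    intro k x hx
    refine support_iteratedFDeriv_subset (𝕜 := ℝ) k ?_
    rw [Function.mem_support, ← norm_ne_zero_iff] at hx ⊢
    rwa [norm_iteratedFDeriv_eq_norm_iteratedDeriv]
  have hint : ∀ k : ℕ, (k : ℕ∞) ≤ (⊤ : ℕ∞) → Integrable (iteratedDeriv k f) volume := by
    intro k hk
    refine Continuous.integrable_of_hasCompactSupport (hf.continuous_iteratedDeriv k
      (by exact_mod_cast le_top)) ?_
    exact hcs.of_isClosed_subset isClosed_closure
      (closure_minimal (hsub k) (isClosed_tsupport f))
  have h := congrFun (Real.fourier_iteratedDeriv (n := n) hf hint le_top) ξ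
  have hnorm : (2 * Real.pi * |ξ|) ^ n * ‖FourierTransform.fourier f ξ‖ =
      ‖FourierTransform.fourier (iteratedDeriv n f) ξ‖ := by
    rw [h, norm_smul, norm_pow]
    simp [abs_of_pos Real.pi_pos]
  rw [hnorm, Real.fourier_real_eq]
  have hset : ∫ v : ℝ, Real.fourierChar (-(v * ξ)) • iteratedDeriv n f v =
      ∫ v in Set.Icc (c - 1) (c + 1), Real.fourierChar (-(v * ξ)) • iteratedDeriv n f v := by
    refine (setIntegral_eq_integral_of_forall_compl_eq_zero fun x hx => ?_).symm
    have : iteratedDeriv n f x = 0 := by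
      by_contra h0
      exact hx (hsupp (hsub n h0))
    rw [this, smul_zero]
  rw [hset]
  refine (norm_setIntegral_le_of_norm_le_const (C := B) (by simp) fun x _ => ?_).trans ?_
  · rw [Circle.norm_smul]
    exact hB x
  · rw [Real.volume_real_Icc]
    have : c + 1 - (c - 1) = 2 := by ring
    rw [this]
    norm_num
    linarith

lemma IsWeightFunction.weightMoment_zero_le_one {ω : ℝ → ℝ} (hω : IsWeightFunction ω) {p : ℕ}
    (hp : 1 ≤ p) : weightMoment ω p 0 ≤ 1 := by
  refine weightMoment_le hp 0 one_pos fun t ht => ?_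
  have := hω.nonneg t (by linarith)
  rw [pow_zero, one_mul, Real.exp_le_one_iff]
  have : 0 ≤ (p : ℝ) * ω t := by positivity
  linarith

/-- Moment bounds for every power of the frequency `ξ` give decay `e^{-N ω}`. -/
lemma IsWeightFunction.exists_decay {ω : ℝ → ℝ} (hω : IsWeightFunction ω) (N : ℕ) :
    ∃ D > 0, ∀ ξ b Q : ℝ, 0 ≤ b → 0 ≤ Q →
      (∀ n : ℕ, (2 * Real.pi * |ξ|) ^ n * b ≤ 2 * (2 ^ (n + 1) * weightMoment ω (N + 1) n * Q)) →
      b ≤ D * Q * Real.exp (-(N * ω |ξ|)) := by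
  obtain ⟨D, hD1, hD⟩ := hω.exists_le_mul_exp
  have h1 := hω.nonneg 1 zero_le_one
  refine ⟨4 * (D * Real.exp (N * ω 1)), by positivity, fun ξ b Q hb hQ h => ?_⟩
  rcases le_total 1 |ξ| with hξ | hξ
  · obtain ⟨n, hn⟩ := hω.exists_weightMoment_le_pow (p := N + 1) (by omega) hξ
    have hx0 : 0 < |ξ| := by linarith
    have h2 : |ξ| * Real.exp (-((N + 1 : ℕ) * ω |ξ|)) ≤ D * Real.exp (-(N * ω |ξ|)) := by
      have e : -(((N + 1 : ℕ) : ℝ) * ω |ξ|) = -ω |ξ| + -(N * ω |ξ|) := by push_cast; ring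
      rw [e, Real.exp_add, ← mul_assoc]
      gcongr
      rw [Real.exp_neg, ← div_eq_mul_inv, div_le_iff₀ (Real.exp_pos _)]
      exact hD _ hξ
    have h3 : (2 * |ξ|) ^ n * b ≤ (2 * |ξ|) ^ n * (4 * D * Q * Real.exp (-(N * ω |ξ|))) := by
      calc (2 * |ξ|) ^ n * b ≤ (2 * Real.pi * |ξ|) ^ n * b := by
            have := Real.pi_gt_three
            gcongr
            linarith
        _ ≤ 2 * (2 ^ (n + 1) * weightMoment ω (N + 1) n * Q) := h n
        _ ≤ 2 * (2 ^ (n + 1) * (|ξ| ^ n * (D * Real.exp (-(N * ω |ξ|)))) * Q) := by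
            have := hn.trans (mul_le_mul_of_nonneg_left h2 (by positivity))
            gcongr
        _ = _ := by ring
    have h4 := le_of_mul_le_mul_left h3 (by positivity)
    refine h4.trans ?_
    have : 1 ≤ Real.exp (N * ω 1) := Real.one_le_exp (by positivity)
    have hd : D ≤ D * Real.exp (N * ω 1) := by nlinarith
    gcongr ?_ * Q * _
    linarith
  · have h0 := h 0
    have hM := hω.weightMoment_zero_le_one (p := N + 1) (by omega)
    have hmono := hω.monotone (Set.mem_Ici.2 (abs_nonneg ξ)) (Set.mem_Ici.2 zero_le_one) hξ
    have h2 : 1 ≤ Real.exp (N * ω 1) * Real.exp (-(N * ω |ξ|)) := by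
      rw [← Real.exp_add]
      refine Real.one_le_exp ?_
      have := mul_le_mul_of_nonneg_left hmono (Nat.cast_nonneg (α := ℝ) N)
      linarith
    have h5 : 1 ≤ D * (Real.exp (N * ω 1) * Real.exp (-(N * ω |ξ|))) := by nlinarith
    have h6 : b ≤ 4 * Q := by
      have h7 := mul_le_mul_of_nonneg_right hM hQ
      simp only [pow_zero, one_mul, zero_add, pow_one] at h0
      linarith
    calc b ≤ 4 * Q := h6
      _ ≤ 4 * Q * (D * (Real.exp (N * ω 1) * Real.exp (-(N * ω |ξ|)))) :=
          le_mul_of_one_le_right (by positivity) h5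
      _ = _ := by ring

lemma tsupport_conj_comp_sub_subset {g : ℝ → ℂ} (hgsupp : tsupport g ⊆ Set.Icc (-1 : ℝ) 1)
    (z : ℝ) : tsupport (fun x => (starRingEnd ℂ) (g (x - z))) ⊆ Set.Icc (z - 1) (z + 1) := by
  refine closure_minimal (fun x hx => ?_) isClosed_Icc
  have h : g (x - z) ≠ 0 := by
    intro h0
    simp [h0] at hx
  have := hgsupp (subset_tsupport g h)
  rw [Set.mem_Icc] at this ⊢
  constructor <;> linarith [this.1, this.2]

lemma integral_stft_eq {φ : ℝ → ℝ} (hφ : Continuous φ) {g : ℝ → ℂ} (hg : Continuous g)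
    (hgsupp : tsupport g ⊆ Set.Icc (-1 : ℝ) 1) (z₁ z₂ ζ₁ ζ₂ : ℝ) :
    ∫ x : ℝ, ∫ y : ℝ, Complex.exp (Complex.I * ((φ x * y : ℝ) : ℂ)) *
          (starRingEnd ℂ) (g (x - z₁)) * (starRingEnd ℂ) (g (y - z₂)) *
          Complex.exp (-(2 * Real.pi * Complex.I) * ((x * ζ₁ + y * ζ₂ : ℝ) : ℂ)) =
      ∫ y : ℝ, (starRingEnd ℂ) (g (y - z₂)) *
        Complex.exp (Complex.I * ((-(2 * Real.pi * (y * ζ₂)) : ℝ) : ℂ)) *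
        FourierTransform.fourier (fun x => (starRingEnd ℂ) (g (x - z₁)) *
          Complex.exp (Complex.I * ((φ x * y : ℝ) : ℂ))) ζ₁ := by
  rw [integral_integral_swap_of_hasCompactSupport]
  · congr 1
    funext y
    rw [Real.fourier_real_eq_integral_exp_smul, ← integral_const_mul]
    congr 1
    funext x
    have : Complex.exp (-(2 * Real.pi * Complex.I) * ((x * ζ₁ + y * ζ₂ : ℝ) : ℂ)) =
        Complex.exp (Complex.I * ((-(2 * Real.pi * (y * ζ₂)) : ℝ) : ℂ)) *
          Complex.exp (((-2 * Real.pi * x * ζ₁ : ℝ) : ℂ) * Complex.I) := by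
      rw [← Complex.exp_add]
      congr 1
      push_cast
      ring
    rw [this, smul_eq_mul]
    ring
  · simp only [Function.uncurry_def]
    fun_prop
  · refine HasCompactSupport.intro (K := Set.Icc (z₁ - 1) (z₁ + 1) ×ˢ Set.Icc (z₂ - 1) (z₂ + 1))
      (isCompact_Icc.prod isCompact_Icc) ?_
    rintro ⟨x, y⟩ hxy
    have aux : ∀ z t : ℝ, t ∉ Set.Icc (z - 1) (z + 1) → (starRingEnd ℂ) (g (t - z)) = 0 := by
      intro z t ht
      by_contra h0
      exact ht (tsupport_conj_comp_sub_subset hgsupp z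
        (subset_tsupport (fun x => (starRingEnd ℂ) (g (x - z))) h0))
    rw [Set.mem_prod, not_and_or] at hxy
    rcases hxy with h | h
    · have := aux z₁ x h
      simp [this]
    · have := aux z₂ y h
      simp [this]

/-- if `φ' ∈ B_{L∞,ω}(ℝ)`, `σ(x,y) = e^{iφ(x)y}` and `g ∈ D_ω` is a
nonzero smooth function supported in `[-1,1]`, then for every `N` there exist
`k ∈ ℕ` and `C > 0` such that
`|V_{g⊗g}σ(z,ζ)| ≤ C e^{-Nω(|ζ₁|) + kω(|z₂|)}`; i.e. `σ ∈ M^∞_m(ℝ²)` with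
`m(z,ζ) = e^{Nω(|ζ₁|) - kω(|z₂|)}`. -/
theorem stmt11 (ω : ℝ → ℝ) (hω : IsWeightFunction ω)
    (φ : ℝ → ℝ) (hφ : ContDiff ℝ (⊤ : ℕ∞) φ)
    (hφ' : ∀ ℓ : ℕ, 1 ≤ ℓ → ∃ A > 0, ∀ k : ℕ, 1 ≤ k → ∀ x : ℝ,
      |iteratedDeriv k φ x| ≤ A * Real.exp ((ℓ : ℝ) * youngConj ω ((k : ℝ) / ℓ)))
    (g : ℝ → ℂ) (hg : ContDiff ℝ (⊤ : ℕ∞) g) (hg0 : g ≠ 0)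
    (hgsupp : tsupport g ⊆ Set.Icc (-1 : ℝ) 1)
    (hgω : ∀ m : ℕ, 1 ≤ m → ∃ Cm > 0, ∀ (k : ℕ) (x : ℝ),
      ‖iteratedDeriv k g x‖ ≤ Cm * Real.exp ((m : ℝ) * youngConj ω ((k : ℝ) / m)))
    (N : ℕ) :
    ∃ k : ℕ, ∃ C > 0, ∀ z₁ z₂ ζ₁ ζ₂ : ℝ,
      ‖∫ x : ℝ, ∫ y : ℝ, Complex.exp (Complex.I * ((φ x * y : ℝ) : ℂ)) *
          (starRingEnd ℂ) (g (x - z₁)) * (starRingEnd ℂ) (g (y - z₂)) *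
          Complex.exp (-(2 * Real.pi * Complex.I) * ((x * ζ₁ + y * ζ₂ : ℝ) : ℂ))‖ ≤
        C * Real.exp (-((N : ℝ) * ω |ζ₁|) + (k : ℝ) * ω |z₂|) := by
  obtain ⟨D₀, hD₀1, hD₀⟩ := hω.exists_weightMoment_succ_le
  obtain ⟨A₀, hA₀, hφA⟩ := hφ' (N + 1 + 1) (by omega)
  obtain ⟨G, hG, hgG⟩ := hgω (N + 1) (by omega)
  obtain ⟨D, hD, hdecay⟩ := hω.exists_decay N
  set p : ℕ := N + 1 with hpdef
  have hp : 1 ≤ p := by omega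
  set A : ℝ := A₀ * D₀ with hAdef
  have hA : 0 < A := by positivity
  have hM0 : ∀ n, 0 < weightMoment ω p n := weightMoment_pos ω p
  have hM := hω.choose_mul_weightMoment_le hp
  have hφM : ∀ (k : ℕ) (x : ℝ), |iteratedDeriv (k + 1) φ x| ≤ A * weightMoment ω p k := by
    intro k x
    refine (hφA (k + 1) (by omega) x).trans ?_
    rw [hAdef, mul_assoc]
    exact mul_le_mul_of_nonneg_left (hD₀ p hp k) hA₀.le
  obtain ⟨L, hL⟩ := exists_nat_ge A
  have hω1 := hω.nonneg 1 zero_le_one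
  have hgbd : ∀ t, ‖g t‖ ≤ G := by
    intro t
    have h := hgG 0 t
    rw [iteratedDeriv_zero] at h
    exact h.trans (mul_le_of_le_one_right hG.le (hω.weightMoment_zero_le_one hp))
  have hfour : ∀ y z₁ ζ₁ : ℝ, ‖FourierTransform.fourier (fun x => (starRingEnd ℂ) (g (x - z₁)) *
      Complex.exp (Complex.I * ((φ x * y : ℝ) : ℂ))) ζ₁‖ ≤
      D * (Real.exp (p * ω 1 + p * ω (A * |y|)) * G) * Real.exp (-(N * ω |ζ₁|)) := by
    intro y z₁ ζ₁
    have hE := contDiff_cexp_I_mul hφ y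
    have hh : ContDiff ℝ (⊤ : ℕ∞) fun x => (starRingEnd ℂ) (g (x - z₁)) :=
      Complex.conjCLE.contDiff.comp (hg.comp (contDiff_id.sub contDiff_const))
    refine hdecay ζ₁ _ _ (norm_nonneg _) (by positivity) fun n => ?_
    refine pow_mul_norm_fourier_le (hh.mul hE) (c := z₁)
      ((tsupport_mul_subset_left).trans (tsupport_conj_comp_sub_subset hgsupp z₁)) (fun x => ?_) ζ₁
    refine norm_iteratedDeriv_mul_le_of_supermultiplicative hM0 hM hE hh (Real.exp_pos _).le hG.le
      (fun m => ?_) (fun m => ?_) n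
    · have h := pow_mul_norm_iteratedDeriv_cexp_le hM0 hM hφ hA.le hφM (y := y)
        (W := Real.exp (p * ω 1 + p * ω (A * |y|))) (Real.exp_pos _).le
        (fun j => hω.pow_le_weightMoment_mul_exp hp j (by positivity)) m 0 x
      simpa using h
    · rw [norm_iteratedDeriv_conj_comp_sub]
      exact hgG m (x - z₁)
  have hweight : ∀ y z₂ : ℝ, y ∈ Set.Icc (z₂ - 1) (z₂ + 1) →
      ω (A * |y|) ≤ (L + 1 : ℕ) * (ω |z₂| + ω 1) := by
    intro y z₂ hy
    have hy1 : |y| ≤ |z₂| + 1 := by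
      have h1 : |y - z₂| ≤ 1 := abs_le.2 ⟨by linarith [hy.1], by linarith [hy.2]⟩
      have h2 := abs_add_le (y - z₂) z₂
      rw [sub_add_cancel] at h2
      linarith
    have hAL : A * |y| ≤ (L + 1 : ℕ) * (|z₂| + 1) := by
      have : A ≤ (L + 1 : ℕ) := by push_cast; linarith
      gcongr
    calc ω (A * |y|) ≤ ω ((L + 1 : ℕ) * (|z₂| + 1)) :=
          hω.monotone (Set.mem_Ici.2 (by positivity)) (Set.mem_Ici.2 (by positivity)) hAL
      _ ≤ (L + 1 : ℕ) * ω (|z₂| + 1) := hω.apply_nat_mul_le L (by positivity)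
      _ ≤ _ := by
          have := hω.subadditive |z₂| 1 (abs_nonneg _) zero_le_one
          gcongr
  set R : ℝ := p * ω 1 + p * ((L + 1 : ℕ) * ω 1) with hR
  refine ⟨p * (L + 1), 2 * (G * (D * G * Real.exp R)), by positivity, fun z₁ z₂ ζ₁ ζ₂ => ?_⟩
  rw [integral_stft_eq hφ.continuous hg.continuous hgsupp]
  rw [← setIntegral_eq_integral_of_forall_compl_eq_zero (s := Set.Icc (z₂ - 1) (z₂ + 1))]
  · refine (norm_setIntegral_le_of_norm_le_const
      (C := G * (D * G * Real.exp R) *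
        Real.exp (-((N : ℝ) * ω |ζ₁|) + ((p * (L + 1) : ℕ) : ℝ) * ω |z₂|))
      (by simp) fun y hy => ?_).trans (le_of_eq ?_)
    · rw [norm_mul, norm_mul, norm_cexp_I_mul_ofReal, mul_one, RCLike.norm_conj]
      have hexp : Real.exp (p * ω 1 + p * ω (A * |y|)) ≤
          Real.exp R * Real.exp (((p * (L + 1) : ℕ) : ℝ) * ω |z₂|) := by
        rw [← Real.exp_add, Real.exp_le_exp, hR]
        have := mul_le_mul_of_nonneg_left (hweight y z₂ hy) (Nat.cast_nonneg (α := ℝ) p)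
        push_cast at this ⊢
        linarith
      calc _ ≤ G * (D * (Real.exp (p * ω 1 + p * ω (A * |y|)) * G) *
            Real.exp (-(N * ω |ζ₁|))) := by
            have h1 := hgbd (y - z₂)
            have h2 := hfour y z₁ ζ₁
            gcongr
        _ ≤ G * (D * (Real.exp R * Real.exp (((p * (L + 1) : ℕ) : ℝ) * ω |z₂|) * G) *
            Real.exp (-(N * ω |ζ₁|))) := by gcongr
        _ = _ := by
            rw [Real.exp_add (-((N : ℝ) * ω |ζ₁|))]
            ring
    · have e : z₂ + 1 - (z₂ - 1) = 2 := by ring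
      rw [Real.volume_real_Icc, e, max_eq_left (by norm_num)]
      ring
  · intro y hy
    have : (starRingEnd ℂ) (g (y - z₂)) = 0 := by
      by_contra h0
      exact hy (tsupport_conj_comp_sub_subset hgsupp z₂
        (subset_tsupport (fun x => (starRingEnd ℂ) (g (x - z₂))) h0))
    rw [this, zero_mul, zero_mul]
end

section
/- Let ω be a subadditive weight function. Let a ∈ [0,1) and let θ:ℝ→ℝ be a smooth function with θ′ ∈ B_{L∞,ω}(ℝ), |θ(x)| = O(|x|^a) as |x|→∞, and ω(x^a) = o(ω(x)) as x→∞; set ψ(x) = x + θ(x). Fix a nonzero window w ∈ S_ω(ℝ). Then for all 0 < s < s′ there exist k > 0 and C > 0 such that for all f, g ∈ S_ω(ℝ): |∫_ℝ f(ψ(x)) · conj(g(x)) dx| ≤ C · (∫_{ℝ²} |V_w f(z)| · e^{s′(ω(|z₁|)+ω(|z₂|)) + k·ω(|z₂|)} dz) · (sup_{z∈ℝ²} |V_w g(z)| · e^{−s(ω(|z₁|)+ω(|z₂|))}). (This expresses the boundedness of the composition operator C_ψ from the ultramodulation space M¹_{m_{s′,k}}(ℝ) to M¹_{v_s}(ℝ),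 where v_s(z) = e^{s(ω(z₁)+ω(z₂))} and m_{s′,k}(z) = v_{s′}(z)e^{k·ω(z₂)}.) -/
open MeasureTheory

/-- Membership in the Gelfand–Shilov space `S_ω(ℝ)`. -/
def InSomega (ω : ℝ → ℝ) (f : ℝ → ℂ) : Prop :=
  ContDiff ℝ (⊤ : ℕ∞) f ∧ ∀ lam > (0 : ℝ), ∀ mu > (0 : ℝ), ∃ C : ℝ, ∀ (k : ℕ) (x : ℝ),
    ‖iteratedDeriv k f x‖ ≤
      C * Real.exp (lam * youngConj ω ((k : ℝ) / lam) - mu * ω |x|)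

/-- The short-time Fourier transform on `ℝ` with window `w`. -/
noncomputable def stft1 (w f : ℝ → ℂ) (z₁ z₂ : ℝ) : ℂ :=
  ∫ t : ℝ, f t * (starRingEnd ℂ) (w (t - z₁)) *
    Complex.exp (-(2 * Real.pi * Complex.I) * ((t * z₂ : ℝ) : ℂ))

open scoped FourierTransform

section WeightFunction

variable {ω : ℝ → ℝ}

theorem IsWeightFunction.abs_add_le (hω : IsWeightFunction ω) (x y : ℝ) :
    ω |x + y| ≤ ω |x| + ω |y| :=
  (hω.monotone (Set.mem_Ici.2 (abs_nonneg _)) (Set.mem_Ici.2 (by positivity))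
    (_root_.abs_add_le x y)).trans (hω.subadditive _ _ (abs_nonneg _) (abs_nonneg _))

theorem IsWeightFunction.natCast_mul_le (hω : IsWeightFunction ω) {c : ℕ} (hc : 1 ≤ c) {t : ℝ}
    (ht : 0 ≤ t) : ω (c * t) ≤ c * ω t := by
  induction c, hc using Nat.le_induction with
  | base => simp
  | succ c _ ih =>
    push_cast
    rw [add_mul, one_mul, add_mul, one_mul]
    exact (hω.subadditive _ _ (by positivity) ht).trans (by linarith)

theorem IsWeightFunction.mul_le_natCeil (hω : IsWeightFunction ω) {c t : ℝ} (hc : 0 < c)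
    (ht : 0 ≤ t) : ω (c * t) ≤ (⌈c⌉₊ : ℝ) * ω t :=
  (hω.monotone (Set.mem_Ici.2 (by positivity)) (Set.mem_Ici.2 (by positivity))
    (mul_le_mul_of_nonneg_right (Nat.le_ceil c) ht)).trans
    (hω.natCast_mul_le (Nat.ceil_pos.2 hc) ht)

theorem IsWeightFunction.exists_log_le (hω : IsWeightFunction ω) {ε : ℝ} (hε : 0 < ε) :
    ∃ C : ℝ, ∀ t : ℝ, 0 ≤ t → Real.log (1 + t ^ 2) ≤ ε * ω t + C := by
  obtain ⟨T, hT⟩ := Filter.eventually_atTop.1 (hω.growth.def hε)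
  refine ⟨Real.log (1 + (max T 0) ^ 2), fun t ht => ?_⟩
  have hpos : 0 ≤ Real.log (1 + (max T 0) ^ 2) :=
    Real.log_nonneg (by nlinarith [sq_nonneg (max T 0)])
  have hω0 := hω.nonneg t ht
  rcases le_total T t with h | h
  · have := hT t h
    rw [Real.norm_of_nonneg hω0] at this
    have h2 := le_abs_self (Real.log (1 + t ^ 2))
    rw [Real.norm_eq_abs] at this
    linarith
  · have : Real.log (1 + t ^ 2) ≤ Real.log (1 + (max T 0) ^ 2) := by
      apply Real.log_le_log (by positivity)
      have : t ≤ max T 0 := h.trans (le_max_left _ _)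
      gcongr
    have := mul_nonneg hε.le hω0
    linarith

theorem IsWeightFunction.exists_one_add_sq_le (hω : IsWeightFunction ω) {ε : ℝ} (hε : 0 < ε) :
    ∃ C > 0, ∀ t : ℝ, 0 ≤ t → 1 + t ^ 2 ≤ C * Real.exp (ε * ω t) := by
  obtain ⟨C, hC⟩ := hω.exists_log_le hε
  refine ⟨Real.exp C, Real.exp_pos _, fun t ht => ?_⟩
  rw [← Real.exp_add, ← Real.log_le_iff_le_exp (by positivity)]
  linarith [hC t ht]

theorem IsWeightFunction.exists_le_exp (hω : IsWeightFunction ω) {ε : ℝ} (hε : 0 < ε) :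
    ∃ C > 0, ∀ t : ℝ, 0 ≤ t → t ≤ C * Real.exp (ε * ω t) := by
  obtain ⟨C, hC, h⟩ := hω.exists_one_add_sq_le hε
  exact ⟨C, hC, fun t ht => le_trans (by nlinarith [sq_nonneg (t - 1)]) (h t ht)⟩

theorem IsWeightFunction.integrable_exp_neg (hω : IsWeightFunction ω) {δ : ℝ} (hδ : 0 < δ) :
    Integrable fun x : ℝ => Real.exp (-(δ * ω |x|)) := by
  obtain ⟨C, hC, h⟩ := hω.exists_one_add_sq_le hδ
  refine (integrable_inv_one_add_sq.const_mul C).mono' ?_ (.of_forall fun x => ?_)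
  · exact (Real.continuous_exp.comp
      ((hω.continuous.comp continuous_abs).const_mul δ).neg).aestronglyMeasurable
  · have := h |x| (abs_nonneg x)
    rw [sq_abs] at this
    rw [Real.norm_of_nonneg (Real.exp_pos _).le, Real.exp_neg, ← div_eq_mul_inv,
      inv_eq_one_div, div_le_div_iff₀ (Real.exp_pos _) (by positivity)]
    linarith

/-- The sequence `exp (ℓ φ*_ω (n / ℓ)) = sup_{t ≥ 1} tⁿ e^{-ℓ ω(t)}`. -/
noncomputable def beurlingSeq (ω : ℝ → ℝ) (ℓ : ℝ) (n : ℕ) : ℝ :=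
  Real.exp (ℓ * youngConj ω ((n : ℝ) / ℓ))

theorem beurlingSeq_pos (ω : ℝ → ℝ) (ℓ : ℝ) (n : ℕ) : 0 < beurlingSeq ω ℓ n := Real.exp_pos _

theorem pow_mul_exp_le_beurlingSeq (hω : IsWeightFunction ω) {ℓ : ℝ} (hℓ : 0 < ℓ) (n : ℕ) {t : ℝ}
    (ht : 1 ≤ t) : t ^ n * Real.exp (-(ℓ * ω t)) ≤ beurlingSeq ω ℓ n := by
  have ht0 : 0 < t := by linarith
  rw [← Real.exp_log (pow_pos ht0 n), ← Real.exp_add, beurlingSeq, Real.exp_le_exp, Real.log_pow]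
  have hbdd : BddAbove ((fun u : ℝ => (n : ℝ) / ℓ * u - ω (Real.exp u)) '' Set.Ici 0) := by
    have hε : 0 < ((n : ℝ) / ℓ + 1)⁻¹ := by positivity
    obtain ⟨C, hC⟩ := hω.exists_log_le hε
    refine ⟨((n : ℝ) / ℓ + 1) * C, ?_⟩
    rintro _ ⟨u, hu, rfl⟩
    have hu' : 0 ≤ u := hu
    have h1 := hC (Real.exp u) (Real.exp_pos u).le
    have h2 : u ≤ Real.log (1 + Real.exp u ^ 2) := by
      rw [Real.le_log_iff_exp_le (by positivity)]
      nlinarith [sq_nonneg (Real.exp u - 1), Real.exp_pos u]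
    have h3 := mul_le_mul_of_nonneg_left (h2.trans h1) (by positivity : 0 ≤ (n : ℝ) / ℓ + 1)
    rw [mul_add, ← mul_assoc, mul_inv_cancel₀ (by positivity), one_mul] at h3
    dsimp only
    linarith
  have := le_csSup hbdd ⟨Real.log t, Real.log_nonneg ht, rfl⟩
  dsimp only at this
  rw [Real.exp_log ht0] at this
  have h := mul_le_mul_of_nonneg_left this hℓ.le
  rw [mul_sub, ← mul_assoc, mul_div_cancel₀ _ hℓ.ne'] at h
  unfold youngConj
  linarith

theorem beurlingSeq_le {ℓ : ℝ} (hℓ : 0 < ℓ) (n : ℕ) {B : ℝ}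
    (h : ∀ t : ℝ, 1 ≤ t → t ^ n * Real.exp (-(ℓ * ω t)) ≤ B) : beurlingSeq ω ℓ n ≤ B := by
  have hB : 0 < B := lt_of_lt_of_le (by positivity) (h 1 le_rfl)
  rw [beurlingSeq, ← Real.le_log_iff_exp_le hB, ← le_div_iff₀' hℓ]
  refine csSup_le (Set.nonempty_Ici.image _) ?_
  rintro _ ⟨u, hu, rfl⟩
  have hu' : 0 ≤ u := hu
  have := h (Real.exp u) (Real.one_le_exp hu')
  rw [← Real.exp_nat_mul, ← Real.exp_add, ← Real.le_log_iff_exp_le hB] at this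
  rw [le_div_iff₀' hℓ, mul_sub, ← mul_assoc, mul_div_cancel₀ _ hℓ.ne']
  linarith

theorem choose_mul_beurlingSeq_le (hω : IsWeightFunction ω) {ℓ : ℝ} (hℓ : 0 < ℓ) (m n : ℕ) :
    ((m + n).choose m : ℝ) * (beurlingSeq ω ℓ m * beurlingSeq ω ℓ n) ≤
      beurlingSeq ω ℓ (m + n) := by
  have hc : (0 : ℝ) < (m + n).choose m := by
    exact_mod_cast Nat.choose_pos (Nat.le_add_right m n)
  have key : ∀ s t : ℝ, 1 ≤ s → 1 ≤ t → ((m + n).choose m : ℝ) *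
      ((s ^ m * Real.exp (-(ℓ * ω s))) * (t ^ n * Real.exp (-(ℓ * ω t)))) ≤
      beurlingSeq ω ℓ (m + n) := by
    intro s t hs ht
    refine le_trans ?_ (pow_mul_exp_le_beurlingSeq hω hℓ (m + n) (t := s + t) (by linarith))
    have h1 : ((m + n).choose m : ℝ) * (s ^ m * t ^ n) ≤ (s + t) ^ (m + n) := by
      rw [add_pow]
      have := Finset.single_le_sum (f := fun k => s ^ k * t ^ (m + n - k) * ((m + n).choose k : ℝ))
        (s := Finset.range (m + n + 1)) (fun i _ => by positivity)
        (Finset.mem_range.2 (by omega : m < m + n + 1))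
      simp only [Nat.add_sub_cancel_left] at this
      linarith
    have h2 : Real.exp (-(ℓ * ω s)) * Real.exp (-(ℓ * ω t)) ≤ Real.exp (-(ℓ * ω (s + t))) := by
      rw [← Real.exp_add, Real.exp_le_exp]
      nlinarith [hω.subadditive s t (by linarith) (by linarith)]
    calc _ = (((m + n).choose m : ℝ) * (s ^ m * t ^ n)) *
          (Real.exp (-(ℓ * ω s)) * Real.exp (-(ℓ * ω t))) := by ring
      _ ≤ _ := by gcongr
  have h1 : ∀ t : ℝ, 1 ≤ t → ((m + n).choose m : ℝ) *
      (beurlingSeq ω ℓ m * (t ^ n * Real.exp (-(ℓ * ω t)))) ≤ beurlingSeq ω ℓ (m + n) := by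
    intro t ht
    have hp : 0 < ((m + n).choose m : ℝ) * (t ^ n * Real.exp (-(ℓ * ω t))) := by positivity
    have := beurlingSeq_le (ω := ω) hℓ m (B := beurlingSeq ω ℓ (m + n) /
      (((m + n).choose m : ℝ) * (t ^ n * Real.exp (-(ℓ * ω t))))) (fun s hs => by
        rw [le_div_iff₀ hp]
        linarith [key s t hs ht])
    rw [le_div_iff₀ hp] at this
    linarith
  have hp : 0 < ((m + n).choose m : ℝ) * beurlingSeq ω ℓ m :=
    mul_pos hc (beurlingSeq_pos _ _ _)
  have := beurlingSeq_le (ω := ω) hℓ n (B := beurlingSeq ω ℓ (m + n) /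
    (((m + n).choose m : ℝ) * beurlingSeq ω ℓ m)) (fun t ht => by
      rw [le_div_iff₀ hp]
      linarith [h1 t ht])
  rw [le_div_iff₀ hp] at this
  linarith

theorem natCast_pow_mul_beurlingSeq_le (hω : IsWeightFunction ω) {ℓ : ℝ} (hℓ : 0 < ℓ) {c : ℕ}
    (hc : 1 ≤ c) (n : ℕ) : (c : ℝ) ^ n * beurlingSeq ω (c * ℓ) n ≤ beurlingSeq ω ℓ n := by
  have hc' : (1 : ℝ) ≤ c := by exact_mod_cast hc
  have hp : (0 : ℝ) < (c : ℝ) ^ n := by positivity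
  have := beurlingSeq_le (ω := ω) (ℓ := c * ℓ) (by positivity) n
    (B := beurlingSeq ω ℓ n / (c : ℝ) ^ n) (fun t ht => by
      rw [le_div_iff₀ hp]
      refine le_trans ?_ (pow_mul_exp_le_beurlingSeq hω hℓ n (t := c * t) (by nlinarith))
      rw [mul_pow]
      have : Real.exp (-(c * ℓ * ω t)) ≤ Real.exp (-(ℓ * ω (c * t))) := by
        rw [Real.exp_le_exp]
        nlinarith [hω.natCast_mul_le hc (by linarith : 0 ≤ t)]
      calc _ = ((c : ℝ) ^ n * t ^ n) * Real.exp (-(c * ℓ * ω t)) := by ring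
        _ ≤ _ := by gcongr)
  rw [le_div_iff₀ hp] at this
  linarith

theorem exists_beurlingSeq_succ_le (hω : IsWeightFunction ω) {ℓ : ℝ} (hℓ : 0 < ℓ) :
    ∃ C > 0, ∀ n : ℕ, beurlingSeq ω (2 * ℓ) (n + 1) ≤ C * beurlingSeq ω ℓ n := by
  obtain ⟨C, hC, h⟩ := hω.exists_le_exp hℓ
  refine ⟨C, hC, fun n => beurlingSeq_le (by positivity) _ fun t ht => ?_⟩
  have ht0 : 0 ≤ t := by linarith
  have e : Real.exp (-(2 * ℓ * ω t)) = Real.exp (-(ℓ * ω t)) * Real.exp (-(ℓ * ω t)) := by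
    rw [← Real.exp_add]; congr 1; ring
  have h1 : t * Real.exp (-(ℓ * ω t)) ≤ C := by
    rw [Real.exp_neg, ← div_eq_mul_inv, div_le_iff₀ (Real.exp_pos _)]
    exact h t ht0
  calc _ = (t * Real.exp (-(ℓ * ω t))) * (t ^ n * Real.exp (-(ℓ * ω t))) := by
        rw [e, pow_succ]; ring
    _ ≤ C * beurlingSeq ω ℓ n := by
        gcongr
        exact pow_mul_exp_le_beurlingSeq hω hℓ n ht

theorem pow_le_exp_mul_beurlingSeq (hω : IsWeightFunction ω) {ℓ : ℝ} (hℓ : 0 < ℓ) (n : ℕ) {r : ℝ}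
    (hr : 0 ≤ r) : r ^ n ≤ Real.exp (ℓ * ω 1) * Real.exp (ℓ * ω r) * beurlingSeq ω ℓ n := by
  have h1 : 0 ≤ ω 1 := hω.nonneg 1 zero_le_one
  have h2 : 0 ≤ ω r := hω.nonneg r hr
  have h3 : ω (max 1 r) ≤ ω 1 + ω r := by
    rcases le_total 1 r with h | h
    · rw [max_eq_right h]; linarith
    · rw [max_eq_left h]; linarith
  have h4 := pow_mul_exp_le_beurlingSeq hω hℓ n (le_max_left 1 r)
  rw [Real.exp_neg, ← div_eq_mul_inv, div_le_iff₀ (Real.exp_pos _)] at h4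
  have hb := beurlingSeq_pos ω ℓ n
  calc r ^ n ≤ (max 1 r) ^ n := by gcongr; exact le_max_right _ _
    _ ≤ _ := h4
    _ ≤ beurlingSeq ω ℓ n * Real.exp (ℓ * ω 1 + ℓ * ω r) := by
        gcongr
        nlinarith
    _ = _ := by rw [Real.exp_add]; ring

theorem beurlingSeq_zero_le_one (hω : IsWeightFunction ω) {ℓ : ℝ} (hℓ : 0 < ℓ) :
    beurlingSeq ω ℓ 0 ≤ 1 :=
  beurlingSeq_le hℓ 0 fun t ht => by
    rw [pow_zero, one_mul, Real.exp_le_one_iff]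
    have := mul_nonneg hℓ.le (hω.nonneg t (by linarith))
    linarith

theorem ConvexOn.exists_subgradient {φ : ℝ → ℝ} (hφ : ConvexOn ℝ Set.univ φ) (x : ℝ) :
    ∃ p : ℝ, ∀ y : ℝ, φ x + p * (y - x) ≤ φ y := by
  refine ⟨derivWithin φ (Set.Ioi x) x, fun y => ?_⟩
  rcases lt_trichotomy x y with h | h | h
  · have := hφ.rightDeriv_le_slope_of_mem_interior (by simp) (Set.mem_univ y) h
    rw [slope_def_field, le_div_iff₀ (by linarith)] at this
    linarith
  · subst h; simp
  · have h1 := hφ.slope_le_leftDeriv_of_mem_interior (Set.mem_univ y)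
      (by simp : x ∈ interior Set.univ) h
    have h2 := hφ.leftDeriv_le_rightDeriv_of_mem_interior (by simp : x ∈ interior Set.univ)
    have := h1.trans h2
    rw [slope_def_field, div_le_iff₀ (by linarith)] at this
    linarith

theorem exists_beurlingSeq_le_pow_mul_exp (hω : IsWeightFunction ω) {ℓ : ℝ} (hℓ : 0 < ℓ) {r : ℝ}
    (hr : 1 ≤ r) : ∃ n : ℕ, beurlingSeq ω ℓ n ≤ r ^ (n + 1) * Real.exp (-(ℓ * ω r)) := by
  have hr0 : 0 < r := by linarith
  obtain ⟨p, hp⟩ := hω.convex.exists_subgradient (Real.log r)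
  simp only [Real.exp_log hr0] at hp
  have hp0 : 0 ≤ p := by
    have h1 := hp (Real.log r - 1)
    have h2 : ω (Real.exp (Real.log r - 1)) ≤ ω r :=
      hω.monotone (Set.mem_Ici.2 (Real.exp_pos _).le) (Set.mem_Ici.2 hr0.le) (by
        conv_rhs => rw [← Real.exp_log hr0]
        exact Real.exp_le_exp.2 (by linarith))
    linarith
  refine ⟨⌊ℓ * p⌋₊, beurlingSeq_le hℓ _ fun t ht => ?_⟩
  have ht0 : 0 < t := by linarith
  set n := ⌊ℓ * p⌋₊
  have hn1 : (n : ℝ) ≤ ℓ * p := Nat.floor_le (by positivity)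
  have hn2 : ℓ * p ≤ n + 1 := (Nat.lt_floor_add_one _).le
  rw [← Real.exp_log (pow_pos ht0 n), ← Real.exp_log (pow_pos hr0 (n + 1)), ← Real.exp_add,
    ← Real.exp_add, Real.exp_le_exp, Real.log_pow, Real.log_pow]
  have h1 := hp (Real.log t)
  rw [Real.exp_log ht0] at h1
  have h2 := mul_le_mul_of_nonneg_left h1 hℓ.le
  have h3 : 0 ≤ Real.log t := Real.log_nonneg ht
  have h4 : 0 ≤ Real.log r := Real.log_nonneg hr
  push_cast
  nlinarith [mul_nonneg (sub_nonneg.2 hn1) h3, mul_nonneg (sub_nonneg.2 hn2) h4]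

end WeightFunction

section Composition

theorem norm_iteratedDeriv_smul_le {f : ℝ → ℝ} {g : ℝ → ℂ} (hf : ContDiff ℝ (⊤ : ℕ∞) f)
    (hg : ContDiff ℝ (⊤ : ℕ∞) g) (n : ℕ) (x : ℝ) :
    ‖iteratedDeriv n (fun y => f y • g y) x‖ ≤ ∑ i ∈ Finset.range (n + 1),
      (n.choose i : ℝ) * ‖iteratedDeriv i f x‖ * ‖iteratedDeriv (n - i) g x‖ := by
  simp only [← norm_iteratedFDeriv_eq_norm_iteratedDeriv]
  exact norm_iteratedFDeriv_smul_le hf hg x (by exact_mod_cast le_top)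

theorem norm_iteratedDeriv_mul_le {f g : ℝ → ℂ} (hf : ContDiff ℝ (⊤ : ℕ∞) f)
    (hg : ContDiff ℝ (⊤ : ℕ∞) g) (n : ℕ) (x : ℝ) :
    ‖iteratedDeriv n (fun y => f y * g y) x‖ ≤ ∑ i ∈ Finset.range (n + 1),
      (n.choose i : ℝ) * ‖iteratedDeriv i f x‖ * ‖iteratedDeriv (n - i) g x‖ := by
  simp only [← norm_iteratedFDeriv_eq_norm_iteratedDeriv]
  exact norm_iteratedFDeriv_mul_le hf hg x (by exact_mod_cast le_top)

theorem sum_range_choose_sub (n k : ℕ) :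
    ∑ i ∈ Finset.range (n + 1), (n - i).choose k = (n + 1).choose (k + 1) := by
  rw [← Nat.sum_Icc_choose, ← Finset.sum_range_reflect]
  rw [Finset.sum_congr rfl (g := fun i => i.choose k) (fun i hi => by
    have := Finset.mem_range.1 hi
    congr 1; omega)]
  symm
  refine Finset.sum_subset (fun i hi => ?_) (fun i hi hi' => ?_)
  · have := Finset.mem_Icc.1 hi
    exact Finset.mem_range.2 (by omega)
  · have := Finset.mem_range.1 hi
    rw [Finset.mem_Icc] at hi'
    exact Nat.choose_eq_zero_of_lt (by omega)

open Nat in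
/-- Quantitative Faà di Bruno bound with respect to a supermultiplicative sequence `N`. -/
theorem norm_iteratedDeriv_comp_le_sum {N : ℕ → ℝ} (hN0 : ∀ n, 0 ≤ N n)
    (hN : ∀ m n, N m * N n ≤ N (m + n)) {A K : ℝ} (hA : 0 ≤ A) (hK : 1 ≤ K * N 0) (hK0 : 0 ≤ K)
    {τ : ℝ → ℝ} (hτ : ContDiff ℝ (⊤ : ℕ∞) τ) (x : ℝ)
    (hb : ∀ j : ℕ, ‖iteratedDeriv (j + 1) τ x‖ ≤ A * (j ! * N j)) (n : ℕ) :
    ∀ F : ℝ → ℂ, ContDiff ℝ (⊤ : ℕ∞) F →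
      ‖iteratedDeriv n (fun y => F (τ y)) x‖ ≤ n ! * ∑ k ∈ Finset.range (n + 1),
        K * (‖iteratedDeriv k F (τ x)‖ * A ^ k / k !) * (n.choose k * N (n - k)) := by
  induction n using Nat.strong_induction_on with
  | _ n ih =>
  intro F hF
  rcases n with _ | n
  · simp only [iteratedDeriv_zero, zero_add, Finset.range_one, Finset.sum_singleton, pow_zero,
      Nat.factorial_zero, Nat.cast_one, Nat.choose_self, Nat.sub_self]
    nlinarith [norm_nonneg (F (τ x))]
  have hF' : ContDiff ℝ (⊤ : ℕ∞) (deriv F) := (contDiff_infty_iff_deriv.1 hF).2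
  have hτ' : ContDiff ℝ (⊤ : ℕ∞) (deriv τ) := (contDiff_infty_iff_deriv.1 hτ).2
  have hderiv : deriv (fun y => F (τ y)) = fun y => deriv τ y • deriv F (τ y) := by
    funext y
    exact ((hF.differentiable (by simp)).differentiableAt.hasDerivAt.scomp y
      (hτ.differentiable (by simp)).differentiableAt.hasDerivAt).deriv
  set P : ℕ → ℝ := fun k => ‖iteratedDeriv k F (τ x)‖ with hP
  have hP0 : ∀ k, 0 ≤ P k := fun k => norm_nonneg _
  rw [iteratedDeriv_succ', hderiv]
  have hterm : ∀ i ∈ Finset.range (n + 1),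
      (n.choose i : ℝ) * ‖iteratedDeriv i (deriv τ) x‖ *
        ‖iteratedDeriv (n - i) (fun y => deriv F (τ y)) x‖ ≤
      n ! * ∑ k ∈ Finset.range (n + 1),
        K * (P (k + 1) * A ^ (k + 1) / k !) * N (n - k) * ((n - i).choose k : ℝ) := by
    intro i hi
    have hi' : i ≤ n := Nat.lt_succ_iff.1 (Finset.mem_range.1 hi)
    have h1 : ‖iteratedDeriv i (deriv τ) x‖ ≤ A * (i ! * N i) := by
      rw [← iteratedDeriv_succ']; exact hb i
    have h2 := ih (n - i) (by omega) (deriv F) hF'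
    simp only [← iteratedDeriv_succ'] at h2
    have hS : ∑ k ∈ Finset.range (n - i + 1),
        K * (P (k + 1) * A ^ k / k !) * ((n - i).choose k * N (n - i - k)) * (A * N i) ≤
        ∑ k ∈ Finset.range (n + 1),
        K * (P (k + 1) * A ^ (k + 1) / k !) * N (n - k) * ((n - i).choose k : ℝ) := by
      refine (Finset.sum_le_sum fun k hk => ?_).trans
        (Finset.sum_le_sum_of_subset_of_nonneg
          (Finset.range_mono (by omega : n - i + 1 ≤ n + 1)) fun k _ _ => ?_)
      · have hk' := Finset.mem_range.1 hk
        have h3 := hN i (n - i - k)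
        rw [show i + (n - i - k) = n - k by omega] at h3
        have h4 := hP0 (k + 1)
        calc _ = K * (P (k + 1) * A ^ (k + 1) / k !) * ((n - i).choose k : ℝ) *
              (N i * N (n - i - k)) := by rw [pow_succ]; ring
          _ ≤ K * (P (k + 1) * A ^ (k + 1) / k !) * ((n - i).choose k : ℝ) * N (n - k) := by
              gcongr
          _ = _ := by ring
      · have := hP0 (k + 1)
        have := hN0 (n - k)
        positivity
    have hfac : (n.choose i : ℝ) * i ! * (n - i)! = n ! := by
      exact_mod_cast Nat.choose_mul_factorial_mul_factorial hi'
    have h0 : 0 ≤ A * (i ! * N i) := mul_nonneg hA (mul_nonneg (by positivity) (hN0 i))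
    calc _ ≤ (n.choose i : ℝ) * (A * (i ! * N i)) * ((n - i)! * ∑ k ∈ Finset.range (n - i + 1),
          K * (P (k + 1) * A ^ k / k !) * ((n - i).choose k * N (n - i - k))) := by
          refine mul_le_mul (by gcongr) h2 (norm_nonneg _) (mul_nonneg (by positivity) h0)
      _ = ((n.choose i : ℝ) * i ! * (n - i)!) * ∑ k ∈ Finset.range (n - i + 1),
          K * (P (k + 1) * A ^ k / k !) * ((n - i).choose k * N (n - i - k)) * (A * N i) := by
          rw [← Finset.sum_mul]; ring
      _ ≤ _ := by rw [hfac]; gcongr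
  refine (norm_iteratedDeriv_smul_le hτ' (hF'.comp hτ) n x).trans
    ((Finset.sum_le_sum hterm).trans ?_)
  rw [← Finset.mul_sum, Finset.sum_comm]
  simp only [← Finset.mul_sum]
  have hsum : ∀ k, ∑ i ∈ Finset.range (n + 1), ((n - i).choose k : ℝ) =
      ((n + 1).choose (k + 1) : ℝ) := fun k => by
    exact_mod_cast sum_range_choose_sub n k
  simp only [hsum]
  rw [Finset.sum_range_succ' _ (n + 1), Finset.mul_sum, mul_add, Finset.mul_sum]
  refine le_add_of_le_of_nonneg (Finset.sum_le_sum fun k hk => ?_) ?_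
  · have hk' : k ≤ n := Nat.lt_succ_iff.1 (Finset.mem_range.1 hk)
    rw [show n + 1 - (k + 1) = n - k by omega]
    have h4 := hP0 (k + 1)
    have h5 := hN0 (n - k)
    have h6 : (n ! : ℝ) / k ! ≤ (n + 1)! / (k + 1)! := by
      rw [div_le_div_iff₀ (by positivity) (by positivity), Nat.factorial_succ, Nat.factorial_succ]
      push_cast
      have : (k : ℝ) ≤ n := by exact_mod_cast hk'
      have : (0 : ℝ) ≤ n ! * k ! := by positivity
      nlinarith
    calc _ = (n ! : ℝ) / k ! *
          (K * (P (k + 1) * A ^ (k + 1)) * N (n - k) * ((n + 1).choose (k + 1) : ℝ)) := by ring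
      _ ≤ (n + 1)! / (k + 1)! *
          (K * (P (k + 1) * A ^ (k + 1)) * N (n - k) * ((n + 1).choose (k + 1) : ℝ)) := by gcongr
      _ = _ := by ring
  · have := hP0 0
    have := hN0 (n + 1 - 0)
    positivity

end Composition

section BeurlingClass

variable {ω : ℝ → ℝ}

open Nat in
theorem beurlingSeq_div_factorial_mul_le (hω : IsWeightFunction ω) {ℓ : ℝ} (hℓ : 0 < ℓ)
    (m n : ℕ) : beurlingSeq ω ℓ m / m ! * (beurlingSeq ω ℓ n / n !) ≤
      beurlingSeq ω ℓ (m + n) / (m + n)! := by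
  have h := choose_mul_beurlingSeq_le hω hℓ m n
  have hf : ((m + n).choose m : ℝ) * m ! * n ! = (m + n)! := by
    have := Nat.choose_mul_factorial_mul_factorial (Nat.le_add_right m n)
    rw [Nat.add_sub_cancel_left] at this
    exact_mod_cast this
  rw [_root_.div_mul_div_comm, div_le_div_iff₀ (by positivity) (by positivity), ← hf]
  calc _ = ((m + n).choose m : ℝ) * (beurlingSeq ω ℓ m * beurlingSeq ω ℓ n) * (m ! * n !) := by
        ring
    _ ≤ _ := by gcongr

open Nat in
/-- Stability of Beurling-type bounds under composition, at a point. -/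
theorem norm_iteratedDeriv_comp_le_beurlingSeq (hω : IsWeightFunction ω) {ℓ : ℝ} (hℓ : 0 < ℓ) :
    ∃ K > 0, ∀ (A Q : ℝ) (τ : ℝ → ℝ) (F : ℝ → ℂ) (x : ℝ), 0 ≤ A →
      ContDiff ℝ (⊤ : ℕ∞) τ → ContDiff ℝ (⊤ : ℕ∞) F →
      (∀ j : ℕ, ‖iteratedDeriv (j + 1) τ x‖ ≤ A * beurlingSeq ω ℓ j) →
      (∀ k : ℕ, ‖iteratedDeriv k F (τ x)‖ * A ^ k ≤ Q * beurlingSeq ω ℓ k) →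
      ∀ n : ℕ, ‖iteratedDeriv n (fun y => F (τ y)) x‖ ≤ K * Q * 2 ^ n * beurlingSeq ω ℓ n := by
  have hb0 := beurlingSeq_pos ω ℓ
  refine ⟨(beurlingSeq ω ℓ 0)⁻¹, inv_pos.2 (hb0 0), fun A Q τ F x hA hτ hF h1 h2 n => ?_⟩
  have hK : 0 < (beurlingSeq ω ℓ 0)⁻¹ := inv_pos.2 (hb0 0)
  have hQ : 0 ≤ Q := by
    have := h2 0
    rw [pow_zero, mul_one] at this
    exact nonneg_of_mul_nonneg_left ((norm_nonneg _).trans this) (hb0 0)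
  have key := norm_iteratedDeriv_comp_le_sum (N := fun n => beurlingSeq ω ℓ n / n !)
    (K := (beurlingSeq ω ℓ 0)⁻¹) (fun n => by have := hb0 n; positivity)
    (beurlingSeq_div_factorial_mul_le hω hℓ) hA
    (by simp [inv_mul_cancel₀ (hb0 0).ne']) hK.le hτ x
    (fun j => by
      rw [mul_div_cancel₀ _ (by positivity)]
      exact h1 j) n F hF
  refine key.trans ?_
  have hsum : ∑ k ∈ Finset.range (n + 1), (beurlingSeq ω ℓ 0)⁻¹ *
      (‖iteratedDeriv k F (τ x)‖ * A ^ k / k !) * (n.choose k * (beurlingSeq ω ℓ (n - k) / (n - k)!))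
      ≤ ∑ k ∈ Finset.range (n + 1),
        (beurlingSeq ω ℓ 0)⁻¹ * Q * (beurlingSeq ω ℓ n / n !) * (n.choose k : ℝ) := by
    refine Finset.sum_le_sum fun k hk => ?_
    have hk' : k ≤ n := Nat.lt_succ_iff.1 (Finset.mem_range.1 hk)
    have h3 := beurlingSeq_div_factorial_mul_le hω hℓ k (n - k)
    rw [Nat.add_sub_cancel' hk'] at h3
    have h4 := hb0 (n - k)
    calc _ ≤ (beurlingSeq ω ℓ 0)⁻¹ * (Q * beurlingSeq ω ℓ k / k !) *
          (n.choose k * (beurlingSeq ω ℓ (n - k) / (n - k)!)) := by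
          exact mul_le_mul_of_nonneg_right (mul_le_mul_of_nonneg_left
            (div_le_div_of_nonneg_right (h2 k) (by positivity)) hK.le) (by positivity)
      _ = (beurlingSeq ω ℓ 0)⁻¹ * Q * n.choose k *
          (beurlingSeq ω ℓ k / k ! * (beurlingSeq ω ℓ (n - k) / (n - k)!)) := by ring
      _ ≤ (beurlingSeq ω ℓ 0)⁻¹ * Q * n.choose k * (beurlingSeq ω ℓ n / n !) := by gcongr
      _ = _ := by ring
  have h2n : ∑ k ∈ Finset.range (n + 1), (n.choose k : ℝ) = 2 ^ n := by
    exact_mod_cast Nat.sum_range_choose n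
  calc _ ≤ (n ! : ℝ) * ∑ k ∈ Finset.range (n + 1),
        (beurlingSeq ω ℓ 0)⁻¹ * Q * (beurlingSeq ω ℓ n / n !) * (n.choose k : ℝ) := by gcongr
    _ = _ := by
        rw [← Finset.mul_sum, h2n]
        field_simp

/-- Stability of Beurling-type bounds under products, at a point. -/
theorem norm_iteratedDeriv_mul_le_beurlingSeq (hω : IsWeightFunction ω) {ℓ : ℝ} (hℓ : 0 < ℓ)
    {U V a : ℝ} (ha : 0 ≤ a) {u v : ℝ → ℂ} (hu : ContDiff ℝ (⊤ : ℕ∞) u)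
    (hv : ContDiff ℝ (⊤ : ℕ∞) v) (x : ℝ)
    (hU : ∀ n : ℕ, ‖iteratedDeriv n u x‖ ≤ U * a ^ n * beurlingSeq ω ℓ n)
    (hV : ∀ n : ℕ, ‖iteratedDeriv n v x‖ ≤ V * a ^ n * beurlingSeq ω ℓ n) (n : ℕ) :
    ‖iteratedDeriv n (fun y => u y * v y) x‖ ≤ U * V * (2 * a) ^ n * beurlingSeq ω ℓ n := by
  have hb0 := beurlingSeq_pos ω ℓ
  have hnn : ∀ {W : ℝ} {f : ℝ → ℂ},
      (∀ n : ℕ, ‖iteratedDeriv n f x‖ ≤ W * a ^ n * beurlingSeq ω ℓ n) → 0 ≤ W := by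
    intro W f h
    have := h 0
    rw [pow_zero, mul_one] at this
    exact nonneg_of_mul_nonneg_left ((norm_nonneg _).trans this) (hb0 0)
  have hU0 := hnn hU
  have hV0 := hnn hV
  refine (norm_iteratedDeriv_mul_le hu hv n x).trans ?_
  have h1 : ∀ i ∈ Finset.range (n + 1),
      (n.choose i : ℝ) * ‖iteratedDeriv i u x‖ * ‖iteratedDeriv (n - i) v x‖ ≤
      U * V * a ^ n * beurlingSeq ω ℓ n := by
    intro i hi
    have hi' : i ≤ n := Nat.lt_succ_iff.1 (Finset.mem_range.1 hi)
    have h3 := choose_mul_beurlingSeq_le hω hℓ i (n - i)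
    rw [Nat.add_sub_cancel' hi'] at h3
    have h4 := hb0 i
    have h5 := hb0 (n - i)
    calc _ ≤ (n.choose i : ℝ) * (U * a ^ i * beurlingSeq ω ℓ i) *
          (V * a ^ (n - i) * beurlingSeq ω ℓ (n - i)) := by
          gcongr
          · exact hU i
          · exact hV _
      _ = U * V * (a ^ i * a ^ (n - i)) *
          ((n.choose i : ℝ) * (beurlingSeq ω ℓ i * beurlingSeq ω ℓ (n - i))) := by ring
      _ ≤ U * V * (a ^ i * a ^ (n - i)) * beurlingSeq ω ℓ n := by gcongr
      _ = _ := by rw [← pow_add, Nat.add_sub_cancel' hi']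
  refine (Finset.sum_le_sum h1).trans ?_
  have h2 : ((n + 1 : ℕ) : ℝ) ≤ 2 ^ n := by exact_mod_cast Nat.lt_two_pow_self
  rw [Finset.sum_const, Finset.card_range, nsmul_eq_mul, mul_pow]
  have := hb0 n
  calc _ ≤ (2 : ℝ) ^ n * (U * V * a ^ n * beurlingSeq ω ℓ n) := by gcongr
    _ = _ := by ring

end BeurlingClass

section FourierDecay

variable {ω : ℝ → ℝ}

theorem exists_norm_fourier_le_of_beurling (hω : IsWeightFunction ω) {ℓ δ : ℝ} (hℓ : 0 < ℓ)
    (hδ : 0 < δ) : ∃ C > 0, ∀ (H : ℝ → ℂ) (Q : ℝ), ContDiff ℝ (⊤ : ℕ∞) H →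
      (∀ (n : ℕ) (x : ℝ), ‖iteratedDeriv n H x‖ ≤
        Q * 8 ^ n * beurlingSeq ω ℓ n * Real.exp (-(δ * ω |x|))) →
      ∀ η : ℝ, ‖𝓕 H η‖ ≤ C * Q * Real.exp (-(ℓ / 4 * ω |η|)) := by
  obtain ⟨C₁, hC₁, hlin⟩ := hω.exists_le_exp (half_pos hℓ)
  have hintg := hω.integrable_exp_neg hδ
  set I := ∫ x : ℝ, Real.exp (-(δ * ω |x|)) with hI
  have hI0 : 0 ≤ I := integral_nonneg fun x => (Real.exp_pos _).le
  refine ⟨(I + 1) * (C₁ + Real.exp (ℓ / 4 * ω 2)), by positivity, fun H Q hH hb η => ?_⟩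
  have hQ : 0 ≤ Q := by
    have := (norm_nonneg _).trans (hb 0 0)
    rw [pow_zero, mul_one, mul_assoc] at this
    exact nonneg_of_mul_nonneg_left this (mul_pos (beurlingSeq_pos _ _ _) (Real.exp_pos _))
  have hcont : ∀ n : ℕ, Continuous (iteratedDeriv n H) := fun n =>
    hH.continuous_iteratedDeriv n (by exact_mod_cast le_top)
  have hInt : ∀ n : ℕ, Integrable (iteratedDeriv n H) := fun n =>
    (hintg.const_mul (Q * 8 ^ n * beurlingSeq ω ℓ n)).mono' (hcont n).aestronglyMeasurable
      (.of_forall (hb n))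
  set r : ℝ := 2 * Real.pi * |η| / 8 with hr
  have hr0 : 0 ≤ r := by positivity
  have key : ∀ n : ℕ, r ^ n * ‖𝓕 H η‖ ≤ Q * I * beurlingSeq ω ℓ n := by
    intro n
    have h1 := congrFun (Real.fourier_iteratedDeriv (N := (⊤ : ℕ∞)) (n := n) hH
      (fun k _ => hInt k) le_top) η
    have h2 : ‖𝓕 (iteratedDeriv n H) η‖ ≤ ∫ x, ‖iteratedDeriv n H x‖ := by
      rw [Real.fourier_real_eq]
      refine (norm_integral_le_integral_norm _).trans_eq ?_
      simp_rw [Circle.norm_smul]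
    have h3 : ∫ x, ‖iteratedDeriv n H x‖ ≤ Q * 8 ^ n * beurlingSeq ω ℓ n * I := by
      rw [hI, ← integral_const_mul]
      exact integral_mono (hInt n).norm (hintg.const_mul _) (hb n)
    have h4 := h2.trans h3
    rw [h1, norm_smul, norm_pow] at h4
    have h5 : ‖(2 * Real.pi * Complex.I * η : ℂ)‖ = 8 * r := by
      simp [hr, abs_of_pos Real.pi_pos]
      ring
    rw [h5, mul_pow] at h4
    have h8 : (0 : ℝ) < 8 ^ n := by positivity
    refine le_of_mul_le_mul_left ?_ h8
    linarith
  have hη2 : |η| ≤ 2 * r := by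
    rw [hr]
    nlinarith [Real.pi_gt_three, abs_nonneg η]
  set E := Real.exp (ℓ / 4 * ω 2) with hE
  have hE0 : 0 < E := Real.exp_pos _
  rcases le_total 1 r with h1 | h1
  · obtain ⟨n, hn⟩ := exists_beurlingSeq_le_pow_mul_exp hω hℓ h1
    have h2 := (key n).trans (mul_le_mul_of_nonneg_left hn (by positivity))
    have h3 : ‖𝓕 H η‖ ≤ Q * I * (r * Real.exp (-(ℓ * ω r))) := by
      refine le_of_mul_le_mul_left ?_ (by positivity : 0 < r ^ n)
      rw [pow_succ] at h2
      linarith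
    have h4 : r * Real.exp (-(ℓ * ω r)) ≤ C₁ * Real.exp (-(ℓ / 4 * ω |η|)) := by
      have h5 : ω |η| ≤ 2 * ω r := by
        refine (hω.monotone (Set.mem_Ici.2 (abs_nonneg _)) (Set.mem_Ici.2 (by positivity))
          hη2).trans ?_
        exact_mod_cast hω.natCast_mul_le (c := 2) (by norm_num) hr0
      calc r * Real.exp (-(ℓ * ω r)) ≤ C₁ * Real.exp (ℓ / 2 * ω r) * Real.exp (-(ℓ * ω r)) := by
            gcongr
            exact hlin r hr0
        _ = C₁ * Real.exp (-(ℓ / 2 * ω r)) := by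
            rw [mul_assoc, ← Real.exp_add]; congr 2; ring
        _ ≤ _ := by
            gcongr C₁ * Real.exp ?_
            nlinarith
    have he : 0 < Real.exp (-(ℓ / 4 * ω |η|)) := Real.exp_pos _
    calc _ ≤ Q * I * (C₁ * Real.exp (-(ℓ / 4 * ω |η|))) :=
          h3.trans (mul_le_mul_of_nonneg_left h4 (by positivity))
      _ ≤ Q * (I + 1) * ((C₁ + E) * Real.exp (-(ℓ / 4 * ω |η|))) := by
          gcongr <;> linarith
      _ = _ := by ring
  · have h2 := key 0
    rw [pow_zero, one_mul] at h2
    have h3 : ω |η| ≤ ω 2 := hω.monotone (Set.mem_Ici.2 (abs_nonneg _))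
      (Set.mem_Ici.2 (by norm_num)) (by linarith)
    have h4 : 1 ≤ E * Real.exp (-(ℓ / 4 * ω |η|)) := by
      rw [hE, ← Real.exp_add, Real.one_le_exp_iff]
      nlinarith
    have he : 0 < Real.exp (-(ℓ / 4 * ω |η|)) := Real.exp_pos _
    calc _ ≤ Q * I * 1 := h2.trans (by gcongr; exact beurlingSeq_zero_le_one hω hℓ)
      _ ≤ Q * (I + 1) * (E * Real.exp (-(ℓ / 4 * ω |η|))) := by gcongr; linarith
      _ ≤ Q * (I + 1) * ((C₁ + E) * Real.exp (-(ℓ / 4 * ω |η|))) := by gcongr; linarith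
      _ = _ := by ring

end FourierDecay

section GelfandShilov

variable {ω : ℝ → ℝ} {f w : ℝ → ℂ}

theorem InSomega.exists_beurling (hf : InSomega ω f) {ℓ μ : ℝ} (hℓ : 0 < ℓ) (hμ : 0 < μ) :
    ∃ C > 0, ∀ (k : ℕ) (x : ℝ),
      ‖iteratedDeriv k f x‖ ≤ C * beurlingSeq ω ℓ k * Real.exp (-(μ * ω |x|)) := by
  obtain ⟨C, hC⟩ := hf.2 ℓ hℓ μ hμ
  refine ⟨|C| + 1, by positivity, fun k x => (hC k x).trans ?_⟩
  rw [sub_eq_add_neg, Real.exp_add, ← mul_assoc]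
  change C * beurlingSeq ω ℓ k * _ ≤ _
  have := beurlingSeq_pos ω ℓ k
  gcongr
  linarith [le_abs_self C]

theorem InSomega.exists_decay (hω : IsWeightFunction ω) (hf : InSomega ω f) {μ : ℝ} (hμ : 0 < μ) :
    ∃ C > 0, ∀ x : ℝ, ‖f x‖ ≤ C * Real.exp (-(μ * ω |x|)) := by
  obtain ⟨C, hC, h⟩ := hf.exists_beurling one_pos hμ
  refine ⟨C, hC, fun x => ?_⟩
  have h1 := h 0 x
  rw [iteratedDeriv_zero] at h1
  refine h1.trans ?_
  have := beurlingSeq_zero_le_one hω one_pos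
  gcongr
  nlinarith

theorem InSomega.exists_bound (hω : IsWeightFunction ω) (hf : InSomega ω f) :
    ∃ C > 0, ∀ x : ℝ, ‖f x‖ ≤ C := by
  obtain ⟨C, hC, h⟩ := hf.exists_decay hω one_pos
  refine ⟨C, hC, fun x => (h x).trans ?_⟩
  have : Real.exp (-(1 * ω |x|)) ≤ 1 := by
    rw [Real.exp_le_one_iff]
    linarith [hω.nonneg |x| (abs_nonneg x)]
  nlinarith

theorem InSomega.integrable (hω : IsWeightFunction ω) (hf : InSomega ω f) : Integrable f := by
  obtain ⟨C, hC, h⟩ := hf.exists_decay hω one_pos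
  exact ((hω.integrable_exp_neg one_pos).const_mul C).mono'
    hf.1.continuous.aestronglyMeasurable (.of_forall h)

theorem InSomega.conj (hf : InSomega ω f) :
    InSomega ω fun x => (starRingEnd ℂ) (f x) := by
  refine ⟨Complex.conjCLE.contDiff.comp hf.1, fun lam hl mu hm => ?_⟩
  obtain ⟨C, hC⟩ := hf.2 lam hl mu hm
  refine ⟨C, fun k x => le_of_eq_of_le ?_ (hC k x)⟩
  rw [← norm_iteratedFDeriv_eq_norm_iteratedDeriv, ← norm_iteratedFDeriv_eq_norm_iteratedDeriv]
  exact Complex.conjLIE.norm_iteratedFDeriv_comp_left f x k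

end GelfandShilov

section TimeFrequency

variable {ω : ℝ → ℝ} {f w : ℝ → ℂ}

/-- The time-frequency shift `x ↦ e^{2πi x z₂} w(x - z₁)`. -/
noncomputable def tfShift (w : ℝ → ℂ) (z : ℝ × ℝ) (x : ℝ) : ℂ :=
  Complex.exp (2 * Real.pi * Complex.I * ((x * z.2 : ℝ) : ℂ)) * w (x - z.1)

theorem norm_tfShift (w : ℝ → ℂ) (z : ℝ × ℝ) (x : ℝ) : ‖tfShift w z x‖ = ‖w (x - z.1)‖ := by
  rw [tfShift, norm_mul,
    show 2 * (Real.pi : ℂ) * Complex.I * ((x * z.2 : ℝ) : ℂ) =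
      ((2 * Real.pi * (x * z.2) : ℝ) : ℂ) * Complex.I by push_cast; ring,
    Complex.norm_exp_ofReal_mul_I, one_mul]

theorem stft1_eq_integral_tfShift (w f : ℝ → ℂ) (z : ℝ × ℝ) :
    stft1 w f z.1 z.2 = ∫ t, f t * (starRingEnd ℂ) (tfShift w z t) := by
  unfold stft1 tfShift
  congr 1
  funext t
  rw [map_mul, ← Complex.exp_conj]
  simp only [map_mul, Complex.conj_ofReal, Complex.conj_I, map_ofNat]
  ring_nf

theorem stft1_eq_fourier (w f : ℝ → ℂ) (z₁ z₂ : ℝ) :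
    stft1 w f z₁ z₂ = 𝓕 (fun t => f t * (starRingEnd ℂ) (w (t - z₁))) z₂ := by
  rw [Real.fourier_real_eq_integral_exp_smul, stft1]
  congr 1
  funext t
  rw [smul_eq_mul, mul_comm]
  congr 2
  push_cast
  ring

theorem continuous_tfShift (hw : Continuous w) :
    Continuous fun p : (ℝ × ℝ) × ℝ => tfShift w p.1 p.2 := by
  unfold tfShift
  fun_prop

theorem stronglyMeasurable_stft1 (hw : Continuous w) (hf : Continuous f) :
    StronglyMeasurable fun z : ℝ × ℝ => stft1 w f z.1 z.2 := by
  simp only [stft1_eq_integral_tfShift]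
  refine StronglyMeasurable.integral_prod_right
    (f := fun (z : ℝ × ℝ) (t : ℝ) => f t * (starRingEnd ℂ) (tfShift w z t)) ?_
  refine Continuous.stronglyMeasurable ?_
  exact (hf.comp continuous_snd).mul (Complex.continuous_conj.comp (continuous_tfShift hw))

theorem iteratedDeriv_translate (w : ℝ → ℂ) (n : ℕ) (s x : ℝ) :
    iteratedDeriv n (fun t => w (t - s)) x = iteratedDeriv n w (x - s) := by
  rw [iteratedDeriv_comp_sub_const]

theorem InSomega.exists_stft1_le (hω : IsWeightFunction ω) (hf : InSomega ω f)
    (hw : InSomega ω w) {μ : ℝ} (hμ : 0 < μ) :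
    ∃ C > 0, ∀ z : ℝ × ℝ, ‖stft1 w f z.1 z.2‖ ≤
      C * Real.exp (-(μ * ω |z.1|)) * Real.exp (-(μ * ω |z.2|)) := by
  have hℓ : 0 < 4 * μ := by positivity
  obtain ⟨C, hC, hF⟩ := exists_norm_fourier_le_of_beurling hω hℓ one_pos
  obtain ⟨Cf, hCf, hbf⟩ := hf.exists_beurling hℓ (by positivity : 0 < μ + 1)
  obtain ⟨Cw, hCw, hbw⟩ := hw.conj.exists_beurling hℓ hμ
  refine ⟨C * (Cf * Cw), by positivity, fun z => ?_⟩
  have hsm : ContDiff ℝ (⊤ : ℕ∞) fun t => (starRingEnd ℂ) (w (t - z.1)) :=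
    hw.conj.1.comp (contDiff_id.sub contDiff_const)
  have := hF (fun t => f t * (starRingEnd ℂ) (w (t - z.1)))
    (Cf * Cw * Real.exp (-(μ * ω |z.1|))) (hf.1.mul hsm) (fun n x => by
      have h1 := norm_iteratedDeriv_mul_le_beurlingSeq hω hℓ
        (U := Cf * Real.exp (-((μ + 1) * ω |x|))) (V := Cw * Real.exp (-(μ * ω |x - z.1|)))
        zero_le_one hf.1 hsm x (fun k => by
          rw [one_pow, mul_one]
          exact (hbf k x).trans_eq (by ring)) (fun k => by
          rw [one_pow, mul_one, iteratedDeriv_translate (fun t => (starRingEnd ℂ) (w t))]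
          exact (hbw k (x - z.1)).trans_eq (by ring)) n
      refine h1.trans ?_
      have h2 : Real.exp (-((μ + 1) * ω |x|)) * Real.exp (-(μ * ω |x - z.1|)) ≤
          Real.exp (-(μ * ω |z.1|)) * Real.exp (-(1 * ω |x|)) := by
        rw [← Real.exp_add, ← Real.exp_add, Real.exp_le_exp]
        have h3 := hω.abs_add_le x (-(x - z.1))
        rw [abs_neg, show x + -(x - z.1) = z.1 by ring] at h3
        nlinarith
      have h4 : ((2 : ℝ) * 1) ^ n ≤ 8 ^ n := by gcongr; norm_num
      have hb := beurlingSeq_pos ω (4 * μ) n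
      calc _ = Cf * Cw * (2 * 1) ^ n * beurlingSeq ω (4 * μ) n *
            (Real.exp (-((μ + 1) * ω |x|)) * Real.exp (-(μ * ω |x - z.1|))) := by ring
        _ ≤ Cf * Cw * 8 ^ n * beurlingSeq ω (4 * μ) n *
            (Real.exp (-(μ * ω |z.1|)) * Real.exp (-(1 * ω |x|))) := by gcongr
        _ = _ := by ring) z.2
  rw [stft1_eq_fourier]
  refine this.trans_eq ?_
  rw [show 4 * μ / 4 = μ by ring]
  ring

theorem IsWeightFunction.integrable_prod_exp_neg (hω : IsWeightFunction ω) {δ ε : ℝ} (hδ : 0 < δ)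
    (hε : 0 < ε) : Integrable fun z : ℝ × ℝ =>
      Real.exp (-(δ * ω |z.1|)) * Real.exp (-(ε * ω |z.2|)) :=
  (hω.integrable_exp_neg hδ).mul_prod (hω.integrable_exp_neg hε)

theorem InSomega.integrable_stft1 (hω : IsWeightFunction ω) (hf : InSomega ω f)
    (hw : InSomega ω w) : Integrable fun z : ℝ × ℝ => stft1 w f z.1 z.2 := by
  obtain ⟨C, hC, h⟩ := hf.exists_stft1_le hω hw one_pos
  refine ((hω.integrable_prod_exp_neg one_pos one_pos).const_mul C).mono'
    (stronglyMeasurable_stft1 hw.1.continuous hf.1.continuous).aestronglyMeasurable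
    (.of_forall fun z => (h z).trans_eq (by ring))

theorem InSomega.integral_stft1_mul_exp (hω : IsWeightFunction ω) (hf : InSomega ω f)
    (hw : InSomega ω w) (z₁ t : ℝ) :
    ∫ z₂ : ℝ, stft1 w f z₁ z₂ * Complex.exp (2 * Real.pi * Complex.I * ((t * z₂ : ℝ) : ℂ)) =
      f t * (starRingEnd ℂ) (w (t - z₁)) := by
  set H : ℝ → ℂ := fun t => f t * (starRingEnd ℂ) (w (t - z₁)) with hH
  have hcont : Continuous H := hf.1.continuous.mul
    (hw.conj.1.continuous.comp (continuous_id.sub continuous_const))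
  have hintg : Integrable H := by
    obtain ⟨B, hB, hb⟩ := hw.exists_bound hω
    refine ((hf.integrable hω).norm.mul_const B).mono' hcont.aestronglyMeasurable
      (.of_forall fun x => ?_)
    rw [hH, norm_mul, RCLike.norm_conj]
    gcongr
    exact hb _
  have hfour : 𝓕 H = fun z₂ => stft1 w f z₁ z₂ := by
    funext z₂
    rw [stft1_eq_fourier]
  have hintg' : Integrable (𝓕 H) := by
    rw [hfour]
    obtain ⟨C, hC, h⟩ := hf.exists_stft1_le hω hw one_pos
    refine ((hω.integrable_exp_neg one_pos).const_mul (C * Real.exp (-(1 * ω |z₁|)))).mono'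
      ((stronglyMeasurable_stft1 hw.1.continuous hf.1.continuous).comp_measurable
        measurable_prodMk_left).aestronglyMeasurable (.of_forall fun z₂ => h (z₁, z₂))
  have := hintg.fourierInv_fourier_eq hintg' (v := t) hcont.continuousAt
  rw [Real.fourierInv_eq', hfour] at this
  refine Eq.trans ?_ this
  congr 1
  funext z₂
  rw [smul_eq_mul, mul_comm]
  congr 2
  simp
  ring

/-- Inversion formula for the short-time Fourier transform. -/
theorem InSomega.integral_stft1_mul_tfShift (hω : IsWeightFunction ω) (hf : InSomega ω f)
    (hw : InSomega ω w) (t : ℝ) :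
    ∫ z : ℝ × ℝ, stft1 w f z.1 z.2 * tfShift w z t = f t * ((∫ x, ‖w x‖ ^ 2 : ℝ) : ℂ) := by
  have hintg : Integrable fun z : ℝ × ℝ => stft1 w f z.1 z.2 * tfShift w z t := by
    obtain ⟨B, hB, hb⟩ := hw.exists_bound hω
    refine ((hf.integrable_stft1 hω hw).norm.mul_const B).mono'
      ((stronglyMeasurable_stft1 hw.1.continuous hf.1.continuous).aestronglyMeasurable.mul
      ((continuous_tfShift hw.1.continuous).comp
        (continuous_id.prodMk continuous_const)).aestronglyMeasurable) (.of_forall fun z => ?_)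
    rw [norm_mul, norm_tfShift]
    gcongr
    exact hb _
  rw [Measure.volume_eq_prod, integral_prod _ hintg]
  have hinner : ∀ z₁ : ℝ, ∫ z₂ : ℝ, stft1 w f z₁ z₂ * tfShift w (z₁, z₂) t =
      f t * ((‖w (t - z₁)‖ ^ 2 : ℝ) : ℂ) := by
    intro z₁
    have := hf.integral_stft1_mul_exp hω hw z₁ t
    simp only [tfShift, ← mul_assoc]
    rw [integral_mul_const, this, mul_assoc, mul_comm (starRingEnd ℂ _), Complex.mul_conj,
      Complex.normSq_eq_norm_sq]
  simp only [hinner]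
  rw [integral_const_mul, integral_complex_ofReal,
    integral_sub_left_eq_self (fun x => ‖w x‖ ^ 2) volume t]

/-- Weak form of the inversion formula, composed with a continuous map. -/
theorem InSomega.integral_comp_mul (hω : IsWeightFunction ω) (hf : InSomega ω f)
    (hw : InSomega ω w) {τ : ℝ → ℝ} (hτ : Continuous τ) {p : ℝ → ℂ} (hp : Continuous p)
    (hp' : Integrable p) :
    (∫ x, f (τ x) * p x) * ((∫ x, ‖w x‖ ^ 2 : ℝ) : ℂ) =
      ∫ z : ℝ × ℝ, stft1 w f z.1 z.2 * ∫ x, tfShift w z (τ x) * p x := by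
  have hintg : Integrable (Function.uncurry fun (x : ℝ) (z : ℝ × ℝ) =>
      stft1 w f z.1 z.2 * (tfShift w z (τ x) * p x)) (volume.prod volume) := by
    obtain ⟨B, hB, hb⟩ := hw.exists_bound hω
    refine ((hp'.norm.mul_prod (hf.integrable_stft1 hω hw).norm).mul_const B).mono' ?_
      (.of_forall fun q => ?_)
    · refine (((stronglyMeasurable_stft1 hw.1.continuous hf.1.continuous).comp_measurable
        measurable_snd).aestronglyMeasurable).mul (Continuous.aestronglyMeasurable ?_)
      exact ((continuous_tfShift hw.1.continuous).comp
        (continuous_snd.prodMk (hτ.comp continuous_fst))).mul (hp.comp continuous_fst)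
    · simp only [Function.uncurry, norm_mul, norm_tfShift]
      have := hb (τ q.1 - q.2.1)
      calc _ = ‖p q.1‖ * ‖stft1 w f q.2.1 q.2.2‖ * ‖w (τ q.1 - q.2.1)‖ := by ring
        _ ≤ _ := by gcongr
  calc _ = ∫ x, ∫ z : ℝ × ℝ, stft1 w f z.1 z.2 * (tfShift w z (τ x) * p x) := by
        rw [← integral_mul_const]
        congr 1
        funext x
        rw [mul_right_comm, ← hf.integral_stft1_mul_tfShift hω hw, ← integral_mul_const]
        simp only [mul_assoc]
    _ = _ := by
        rw [integral_integral_swap hintg]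
        simp only [integral_const_mul]

end TimeFrequency

section CompositionOperator

variable {ω : ℝ → ℝ} {θ : ℝ → ℝ} {w : ℝ → ℂ}

theorem IsWeightFunction.exists_comp_le (hω : IsWeightFunction ω) {a : ℝ} (ha0 : 0 ≤ a)
    (hθa : ∃ C₀ > 0, ∀ x : ℝ, |θ x| ≤ C₀ * (1 + |x|) ^ a)
    (hωa : (fun x : ℝ => ω (x ^ a)) =o[Filter.atTop] ω) {ε : ℝ} (hε : 0 < ε) :
    ∃ C : ℝ, ∀ x : ℝ, ω |θ x| ≤ ε * ω |x| + C := by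
  obtain ⟨C₀, hC₀, hθ⟩ := hθa
  set m : ℕ := ⌈C₀⌉₊
  have hm : 0 < m := Nat.ceil_pos.2 hC₀
  have hm' : (0 : ℝ) < m := by exact_mod_cast hm
  obtain ⟨T, hT⟩ := Filter.eventually_atTop.1 (hωa.def (by positivity : 0 < ε / m))
  set T' := max T 1
  have hT'0 : 0 ≤ T' := le_trans zero_le_one (le_max_right _ _)
  have h1 : ∀ y : ℝ, 1 ≤ y → ω (y ^ a) ≤ ε / m * ω y + ω (T' ^ a) := by
    intro y hy
    have hω1 := hω.nonneg (T' ^ a) (by positivity)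
    have hω2 := hω.nonneg y (by linarith)
    rcases le_total T' y with h | h
    · have h2 := hT y ((le_max_left _ _).trans h)
      rw [Real.norm_of_nonneg hω2, Real.norm_eq_abs] at h2
      linarith [le_abs_self (ω (y ^ a))]
    · have h2 : ω (y ^ a) ≤ ω (T' ^ a) := hω.monotone (Set.mem_Ici.2 (by positivity))
        (Set.mem_Ici.2 (by positivity)) (Real.rpow_le_rpow (by linarith) h ha0)
      have : 0 ≤ ε / m * ω y := by positivity
      linarith
  refine ⟨ε * ω 1 + m * ω (T' ^ a), fun x => ?_⟩
  have hx := abs_nonneg x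
  have h2 : ω |θ x| ≤ m * ω ((1 + |x|) ^ a) :=
    (hω.monotone (Set.mem_Ici.2 (abs_nonneg _)) (Set.mem_Ici.2 (by positivity)) (hθ x)).trans
      (hω.mul_le_natCeil hC₀ (by positivity))
  have h3 := h1 (1 + |x|) (by linarith)
  have h4 := hω.subadditive 1 |x| zero_le_one hx
  calc ω |θ x| ≤ m * (ε / m * ω (1 + |x|) + ω (T' ^ a)) := h2.trans (by gcongr)
    _ = ε * ω (1 + |x|) + m * ω (T' ^ a) := by field_simp
    _ ≤ ε * (ω 1 + ω |x|) + m * ω (T' ^ a) := by gcongr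
    _ = _ := by ring

theorem IsWeightFunction.exists_mul_le_comp (hω : IsWeightFunction ω) {a : ℝ} (ha0 : 0 ≤ a)
    (hθa : ∃ C₀ > 0, ∀ x : ℝ, |θ x| ≤ C₀ * (1 + |x|) ^ a)
    (hωa : (fun x : ℝ => ω (x ^ a)) =o[Filter.atTop] ω) {s s' : ℝ} (hs' : 0 < s') (h : s < s') :
    ∃ C : ℝ, ∀ x : ℝ, s * ω |x| ≤ s' * ω |x + θ x| + C := by
  obtain ⟨C, hC⟩ := hω.exists_comp_le ha0 hθa hωa
    (by have := sub_pos.2 h; positivity : 0 < (s' - s) / s')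
  refine ⟨s' * C, fun x => ?_⟩
  have h1 := hω.abs_add_le (x + θ x) (-θ x)
  rw [abs_neg, add_neg_cancel_right] at h1
  have h2 := mul_le_mul_of_nonneg_left (h1.trans (add_le_add_right (hC x) _)) hs'.le
  have h3 : s' * ((s' - s) / s' * ω |x|) = (s' - s) * ω |x| := by field_simp
  linarith

theorem exists_norm_iteratedDeriv_succ_le (hω : IsWeightFunction ω)
    (hθ' : ∀ ℓ : ℕ, 1 ≤ ℓ → ∃ A > 0, ∀ k : ℕ, 1 ≤ k → ∀ x : ℝ,
      |iteratedDeriv k θ x| ≤ A * Real.exp ((ℓ : ℝ) * youngConj ω ((k : ℝ) / ℓ)))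
    {ℓ : ℕ} (hℓ : 1 ≤ ℓ) :
    ∃ A > 0, ∀ (j : ℕ) (x : ℝ), ‖iteratedDeriv (j + 1) θ x‖ ≤ A * beurlingSeq ω ℓ j := by
  obtain ⟨A, hA, h⟩ := hθ' (2 * ℓ) (by omega)
  have hℓ' : (0 : ℝ) < ℓ := by exact_mod_cast hℓ
  obtain ⟨C, hC, hs⟩ := exists_beurlingSeq_succ_le hω hℓ'
  refine ⟨A * C, by positivity, fun j x => ?_⟩
  have h1 := h (j + 1) (by omega) x
  rw [Nat.cast_mul, Nat.cast_ofNat] at h1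
  change _ ≤ A * beurlingSeq ω (2 * ℓ) (j + 1) at h1
  rw [Real.norm_eq_abs, mul_assoc]
  exact h1.trans (mul_le_mul_of_nonneg_left (hs j) hA.le)

theorem norm_iteratedDeriv_succ_id_add_le (hω : IsWeightFunction ω)
    (hθ : ContDiff ℝ (⊤ : ℕ∞) θ) {ℓ A : ℝ} (hℓ : 0 < ℓ)
    (h : ∀ (j : ℕ) (x : ℝ), ‖iteratedDeriv (j + 1) θ x‖ ≤ A * beurlingSeq ω ℓ j) (j : ℕ) (x : ℝ) :
    ‖iteratedDeriv (j + 1) (fun y => y + θ y) x‖ ≤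
      (Real.exp (ℓ * ω 1) + A) * beurlingSeq ω ℓ j := by
  have hθ1 : ContDiff ℝ (⊤ : ℕ∞) (deriv θ) := (contDiff_infty_iff_deriv.1 hθ).2
  have hd : deriv (fun y => y + θ y) = fun y => 1 + deriv θ y := by
    funext y
    exact ((hasDerivAt_id y).add
      (hθ.differentiable (by simp)).differentiableAt.hasDerivAt).deriv
  have h1 : ‖iteratedDeriv j (fun _ : ℝ => (1 : ℝ)) x‖ ≤ 1 := by
    rw [iteratedDeriv_const]
    split_ifs <;> simp
  have h2 : 1 ≤ Real.exp (ℓ * ω 1) * beurlingSeq ω ℓ j := by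
    have := pow_mul_exp_le_beurlingSeq hω hℓ j le_rfl
    rw [one_pow, one_mul, Real.exp_neg, inv_le_iff_one_le_mul₀' (Real.exp_pos _)] at this
    exact this
  rw [iteratedDeriv_succ', hd, iteratedDeriv_fun_add contDiff_const.contDiffAt
    (hθ1.of_le (by exact_mod_cast le_top)).contDiffAt, add_mul]
  refine (norm_add_le _ _).trans (add_le_add (h1.trans h2) ?_)
  rw [← iteratedDeriv_succ']
  exact h j x

theorem norm_iteratedDeriv_cexp (b : ℝ) (k : ℕ) (y : ℝ) :
    ‖iteratedDeriv k (fun t : ℝ => Complex.exp (((2 * Real.pi * b * t : ℝ) : ℂ) * Complex.I)) y‖ =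
      (2 * Real.pi * |b|) ^ k := by
  have key : iteratedDeriv k
      (fun t : ℝ => Complex.exp (((2 * Real.pi * b * t : ℝ) : ℂ) * Complex.I)) =
      fun t : ℝ => ((2 * Real.pi * b : ℝ) * Complex.I) ^ k *
        Complex.exp (((2 * Real.pi * b * t : ℝ) : ℂ) * Complex.I) := by
    induction k with
    | zero => simp
    | succ k ih =>
      rw [iteratedDeriv_succ, ih]
      funext t
      have h1 : HasDerivAt (fun t : ℝ => ((2 * Real.pi * b * t : ℝ) : ℂ) * Complex.I)
          ((2 * Real.pi * b : ℝ) * Complex.I) t := by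
        have := (((hasDerivAt_id t).const_mul (2 * Real.pi * b)).ofReal_comp).mul_const Complex.I
        simpa using this
      rw [(h1.cexp.const_mul _).deriv]
      ring
  rw [key, norm_mul, Complex.norm_exp_ofReal_mul_I, norm_pow, norm_mul, Complex.norm_I,
    Complex.norm_real, Real.norm_eq_abs, abs_mul, abs_of_pos Real.two_pi_pos]
  simp

/-- The short-time Fourier transform of a warped time-frequency shift is concentrated. -/
theorem exists_stft1_tfShift_comp_le (hω : IsWeightFunction ω) {a : ℝ} (ha0 : 0 ≤ a)
    (hθ : ContDiff ℝ (⊤ : ℕ∞) θ)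
    (hθ' : ∀ ℓ : ℕ, 1 ≤ ℓ → ∃ A > 0, ∀ k : ℕ, 1 ≤ k → ∀ x : ℝ,
      |iteratedDeriv k θ x| ≤ A * Real.exp ((ℓ : ℝ) * youngConj ω ((k : ℝ) / ℓ)))
    (hθa : ∃ C₀ > 0, ∀ x : ℝ, |θ x| ≤ C₀ * (1 + |x|) ^ a)
    (hωa : (fun x : ℝ => ω (x ^ a)) =o[Filter.atTop] ω) (hw : InSomega ω w)
    {s s' : ℝ} (hs : 0 < s) (hss' : s < s') :
    ∃ δ > 0, ∃ k > 0, ∃ C > 0, ∀ z ζ : ℝ × ℝ,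
      ‖stft1 w (fun x => tfShift w z (x + θ x)) ζ.1 ζ.2‖ *
          Real.exp (s * (ω |ζ.1| + ω |ζ.2|)) ≤
        C * Real.exp (s' * ω |z.1| + k * ω |z.2|) *
          (Real.exp (-(δ * ω |ζ.1|)) * Real.exp (-(1 * ω |ζ.2 - z.2|))) := by
  have hs'0 : 0 < s' := hs.trans hss'
  obtain ⟨δ, hδ, hδs⟩ : ∃ δ : ℝ, 0 < δ ∧ s + 2 * δ < s' :=
    ⟨(s' - s) / 4, by linarith, by linarith⟩
  obtain ⟨C₁, hC₁⟩ := hω.exists_mul_le_comp ha0 hθa hωa hs'0 hδs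
  obtain ⟨ℓ, hℓ1, hℓs⟩ : ∃ ℓ : ℕ, 1 ≤ ℓ ∧ s + 1 ≤ (ℓ : ℝ) / 4 :=
    ⟨⌈4 * (s + 1)⌉₊, Nat.one_le_ceil_iff.2 (by positivity), by
      linarith [Nat.le_ceil (4 * (s + 1))]⟩
  have hℓ : (0 : ℝ) < ℓ := by exact_mod_cast hℓ1
  obtain ⟨A, hA, hθA⟩ := exists_norm_iteratedDeriv_succ_le hω hθ' hℓ1
  set B : ℝ := Real.exp (ℓ * ω 1) + A
  have hB : 0 < B := by positivity
  have hψB := norm_iteratedDeriv_succ_id_add_le hω hθ hℓ hθA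
  have hψ : ContDiff ℝ (⊤ : ℕ∞) fun y => y + θ y := contDiff_id.add hθ
  obtain ⟨K, hK, hcomp⟩ := norm_iteratedDeriv_comp_le_beurlingSeq hω hℓ
  obtain ⟨CF, hCF, hF⟩ := exists_norm_fourier_le_of_beurling hω hℓ hδ
  set cB : ℕ := ⌈B⌉₊
  have hcB : 1 ≤ cB := Nat.ceil_pos.2 hB
  have hcB' : (0 : ℝ) < cB := by exact_mod_cast hcB
  obtain ⟨Cw, hCw, hbw⟩ := hw.exists_beurling (by positivity : 0 < cB * (ℓ : ℝ)) hs'0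
  obtain ⟨Cv, hCv, hbv⟩ := hw.conj.exists_beurling hℓ (by positivity : 0 < s + δ)
  set c : ℕ := ⌈2 * Real.pi * A⌉₊
  have hpiA : 0 < 2 * Real.pi * A := by positivity
  set E : ℝ := Real.exp (ℓ * ω 1) with hE
  have hE0 : 0 < E := Real.exp_pos _
  refine ⟨δ, hδ, ℓ * c + s, by positivity, CF * (K * E * (K * Cw) * Cv * Real.exp C₁),
    by positivity, fun z ζ => ?_⟩
  set u : ℝ → ℂ := fun x => Complex.exp (((2 * Real.pi * z.2 * θ x : ℝ) : ℂ) * Complex.I) with hu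
  set v : ℝ → ℂ := fun x => w ((x + θ x) - z.1) with hv
  set p : ℝ → ℂ := fun x => (starRingEnd ℂ) (w (x - ζ.1)) with hp
  have hFu : ContDiff ℝ (⊤ : ℕ∞)
      fun t : ℝ => Complex.exp (((2 * Real.pi * z.2 * t : ℝ) : ℂ) * Complex.I) :=
    ((Complex.ofRealCLM.contDiff.comp (contDiff_const.mul contDiff_id)).mul contDiff_const).cexp
  have hFv : ContDiff ℝ (⊤ : ℕ∞) fun t : ℝ => w (t - z.1) :=
    hw.1.comp (contDiff_id.sub contDiff_const)
  have hus : ContDiff ℝ (⊤ : ℕ∞) u := hFu.comp hθ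
  have hvs : ContDiff ℝ (⊤ : ℕ∞) v := hFv.comp hψ
  have hps : ContDiff ℝ (⊤ : ℕ∞) p := hw.conj.1.comp (contDiff_id.sub contDiff_const)
  have hub : ∀ x n, ‖iteratedDeriv n u x‖ ≤
      K * (E * Real.exp (ℓ * (c * ω |z.2|))) * 2 ^ n * beurlingSeq ω ℓ n := by
    intro x n
    refine hcomp A _ θ _ x hA.le hθ hFu (fun j => hθA j x) (fun k => ?_) n
    rw [norm_iteratedDeriv_cexp, ← mul_pow]
    refine (pow_le_exp_mul_beurlingSeq hω hℓ k (by positivity)).trans ?_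
    have h1 : ω (2 * Real.pi * |z.2| * A) ≤ c * ω |z.2| := by
      rw [mul_right_comm]
      exact hω.mul_le_natCeil hpiA (abs_nonneg _)
    have := beurlingSeq_pos ω ℓ k
    gcongr
  have hvb : ∀ x n, ‖iteratedDeriv n v x‖ ≤
      K * (Cw * Real.exp (-(s' * ω |(x + θ x) - z.1|))) * 2 ^ n * beurlingSeq ω ℓ n := by
    intro x n
    refine hcomp B _ (fun y => y + θ y) _ x hB.le hψ hFv (fun j => hψB j x) (fun k => ?_) n
    rw [iteratedDeriv_translate]
    have h1 := natCast_pow_mul_beurlingSeq_le hω hℓ hcB k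
    have h2 : B ^ k ≤ (cB : ℝ) ^ k := by gcongr; exact Nat.le_ceil B
    have h3 := beurlingSeq_pos ω (cB * ℓ) k
    calc _ ≤ (Cw * beurlingSeq ω (cB * ℓ) k * Real.exp (-(s' * ω |(x + θ x) - z.1|))) *
          (cB : ℝ) ^ k := by
          gcongr
          exact hbw k _
      _ = Cw * Real.exp (-(s' * ω |(x + θ x) - z.1|)) *
          ((cB : ℝ) ^ k * beurlingSeq ω (cB * ℓ) k) := by ring
      _ ≤ _ := by gcongr
  have hpb : ∀ x n, ‖iteratedDeriv n p x‖ ≤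
      Cv * Real.exp (-((s + δ) * ω |x - ζ.1|)) * 4 ^ n * beurlingSeq ω ℓ n := by
    intro x n
    rw [hp, iteratedDeriv_translate (fun t => (starRingEnd ℂ) (w t))]
    refine (hbv n _).trans ?_
    have h1 : (1 : ℝ) ≤ 4 ^ n := one_le_pow₀ (by norm_num)
    have := beurlingSeq_pos ω ℓ n
    calc _ = Cv * Real.exp (-((s + δ) * ω |x - ζ.1|)) * 1 * beurlingSeq ω ℓ n := by ring
      _ ≤ _ := by gcongr
  have hfour := hF (fun x => (u x * v x) * p x)
    (K * E * (K * Cw) * Cv * Real.exp C₁ *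
      (Real.exp (ℓ * (c * ω |z.2|)) * Real.exp (s' * ω |z.1|) *
        Real.exp (-((s + δ) * ω |ζ.1|)))) ((hus.mul hvs).mul hps) (fun n x => by
      have h1 := norm_iteratedDeriv_mul_le_beurlingSeq hω hℓ (by norm_num : (0 : ℝ) ≤ 4)
        (hus.mul hvs) hps x (fun k => by
          have := norm_iteratedDeriv_mul_le_beurlingSeq hω hℓ (by norm_num : (0 : ℝ) ≤ 2)
            hus hvs x (hub x) (hvb x) k
          rwa [show (2 : ℝ) * 2 = 4 by norm_num] at this) (hpb x) n
      rw [show (2 : ℝ) * 4 = 8 by norm_num] at h1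
      refine h1.trans ?_
      have h2 : Real.exp (-(s' * ω |(x + θ x) - z.1|)) * Real.exp (-((s + δ) * ω |x - ζ.1|)) ≤
          Real.exp C₁ * Real.exp (s' * ω |z.1|) * Real.exp (-((s + δ) * ω |ζ.1|)) *
            Real.exp (-(δ * ω |x|)) := by
        rw [← Real.exp_add, ← Real.exp_add, ← Real.exp_add, ← Real.exp_add, Real.exp_le_exp]
        have h3 := hω.abs_add_le x (-(x - ζ.1))
        rw [abs_neg, show x + -(x - ζ.1) = ζ.1 by ring] at h3
        have h4 := hω.abs_add_le ((x + θ x) - z.1) z.1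
        rw [sub_add_cancel] at h4
        have h5 := hC₁ x
        have h6 := mul_le_mul_of_nonneg_left h3 (by positivity : 0 ≤ s + δ)
        have h7 := mul_le_mul_of_nonneg_left h4 hs'0.le
        linarith
      have hb := beurlingSeq_pos ω ℓ n
      calc _ = K * E * (K * Cw) * Cv * Real.exp (ℓ * (c * ω |z.2|)) * 8 ^ n *
            beurlingSeq ω ℓ n * (Real.exp (-(s' * ω |(x + θ x) - z.1|)) *
              Real.exp (-((s + δ) * ω |x - ζ.1|))) := by ring
        _ ≤ K * E * (K * Cw) * Cv * Real.exp (ℓ * (c * ω |z.2|)) * 8 ^ n *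
            beurlingSeq ω ℓ n * (Real.exp C₁ * Real.exp (s' * ω |z.1|) *
              Real.exp (-((s + δ) * ω |ζ.1|)) * Real.exp (-(δ * ω |x|))) := by gcongr
        _ = _ := by ring) (ζ.2 - z.2)
  have hstft : stft1 w (fun x => tfShift w z (x + θ x)) ζ.1 ζ.2 =
      𝓕 (fun x => (u x * v x) * p x) (ζ.2 - z.2) := by
    rw [stft1_eq_fourier, Real.fourier_real_eq_integral_exp_smul,
      Real.fourier_real_eq_integral_exp_smul]
    congr 1
    funext x
    simp only [tfShift, hu, hv, hp, smul_eq_mul, ← mul_assoc, ← Complex.exp_add]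
    congr 3
    push_cast
    ring
  rw [hstft]
  have hexp : Real.exp (ℓ * (c * ω |z.2|)) * Real.exp (s' * ω |z.1|) *
      Real.exp (-((s + δ) * ω |ζ.1|)) * Real.exp (-(ℓ / 4 * ω |ζ.2 - z.2|)) *
      Real.exp (s * (ω |ζ.1| + ω |ζ.2|)) ≤
      Real.exp (s' * ω |z.1| + (ℓ * c + s) * ω |z.2|) *
        (Real.exp (-(δ * ω |ζ.1|)) * Real.exp (-(1 * ω |ζ.2 - z.2|))) := by
    simp only [← Real.exp_add]
    rw [Real.exp_le_exp]
    have h1 := hω.abs_add_le (ζ.2 - z.2) z.2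
    rw [sub_add_cancel] at h1
    have h2 := mul_le_mul_of_nonneg_left h1 hs.le
    have h3 := mul_le_mul_of_nonneg_right hℓs (hω.nonneg _ (abs_nonneg (ζ.2 - z.2)))
    linarith
  calc _ ≤ _ := mul_le_mul_of_nonneg_right hfour (Real.exp_pos _).le
    _ = CF * (K * E * (K * Cw) * Cv * Real.exp C₁) * (Real.exp (ℓ * (c * ω |z.2|)) *
        Real.exp (s' * ω |z.1|) * Real.exp (-((s + δ) * ω |ζ.1|)) *
        Real.exp (-(ℓ / 4 * ω |ζ.2 - z.2|)) * Real.exp (s * (ω |ζ.1| + ω |ζ.2|))) := by ring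
    _ ≤ CF * (K * E * (K * Cw) * Cv * Real.exp C₁) *
        (Real.exp (s' * ω |z.1| + (ℓ * c + s) * ω |z.2|) *
        (Real.exp (-(δ * ω |ζ.1|)) * Real.exp (-(1 * ω |ζ.2 - z.2|)))) := by gcongr
    _ = _ := by ring

theorem InSomega.integrable_tfShift_comp (hω : IsWeightFunction ω) {a : ℝ} (ha0 : 0 ≤ a)
    (hθ : ContDiff ℝ (⊤ : ℕ∞) θ)
    (hθa : ∃ C₀ > 0, ∀ x : ℝ, |θ x| ≤ C₀ * (1 + |x|) ^ a)
    (hωa : (fun x : ℝ => ω (x ^ a)) =o[Filter.atTop] ω) (hw : InSomega ω w) (z : ℝ × ℝ) :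
    Integrable fun x => tfShift w z (x + θ x) := by
  obtain ⟨C₁, hC₁⟩ := hω.exists_mul_le_comp ha0 hθa hωa two_pos one_lt_two
  obtain ⟨Cw, hCw, hbw⟩ := hw.exists_decay hω two_pos
  refine ((hω.integrable_exp_neg one_pos).const_mul (Cw * Real.exp (C₁ + 2 * ω |z.1|))).mono'
    ((continuous_tfShift hw.1.continuous).comp (continuous_const.prodMk
      (continuous_id.add hθ.continuous))).aestronglyMeasurable (.of_forall fun x => ?_)
  rw [norm_tfShift]
  refine (hbw _).trans ?_
  rw [mul_assoc, ← Real.exp_add]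
  have h4 := hω.abs_add_le ((x + θ x) - z.1) z.1
  rw [sub_add_cancel] at h4
  have := hC₁ x
  gcongr
  linarith

theorem InSomega.integral_norm_sq_pos (hω : IsWeightFunction ω) (hw : InSomega ω w)
    (hw0 : w ≠ 0) : 0 < ∫ x, ‖w x‖ ^ 2 := by
  obtain ⟨x₀, hx₀⟩ := Function.ne_iff.1 hw0
  obtain ⟨B, hB, hb⟩ := hw.exists_bound hω
  have hcont : Continuous fun x => ‖w x‖ ^ 2 := (hw.1.continuous.norm).pow 2
  refine integral_pos_of_integrable_nonneg_nonzero (x := x₀) hcont ?_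
    (fun x => by positivity) (by simpa using hx₀)
  refine ((hw.integrable hω).norm.const_mul B).mono' hcont.aestronglyMeasurable
    (.of_forall fun x => ?_)
  rw [Real.norm_of_nonneg (by positivity), pow_two]
  gcongr
  exact hb x

end CompositionOperator

section Boundedness

variable {ω : ℝ → ℝ} {w : ℝ → ℂ}

theorem InSomega.bddAbove_stft1_mul_exp (hω : IsWeightFunction ω) {g : ℝ → ℂ}
    (hg : InSomega ω g) (hw : InSomega ω w) {s : ℝ} (hs : 0 ≤ s) :
    BddAbove (Set.range fun z : ℝ × ℝ => ‖stft1 w g z.1 z.2‖ *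
      Real.exp (-(s * (ω |z.1| + ω |z.2|)))) := by
  obtain ⟨C, hC, h⟩ := hg.exists_stft1_le hω hw one_pos
  refine ⟨C, ?_⟩
  rintro _ ⟨z, rfl⟩
  have h1 := hω.nonneg _ (abs_nonneg z.1)
  have h2 := hω.nonneg _ (abs_nonneg z.2)
  have e1 : Real.exp (-(1 * ω |z.1|)) ≤ 1 := Real.exp_le_one_iff.2 (by linarith)
  have e2 : Real.exp (-(1 * ω |z.2|)) ≤ 1 := Real.exp_le_one_iff.2 (by linarith)
  have e3 : Real.exp (-(s * (ω |z.1| + ω |z.2|))) ≤ 1 :=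
    Real.exp_le_one_iff.2 (neg_nonpos.2 (by positivity))
  calc _ ≤ C * 1 * 1 * 1 := by
        refine mul_le_mul ((h z).trans ?_) e3 (Real.exp_pos _).le (by positivity)
        gcongr
    _ = C := by ring

theorem InSomega.integrable_norm_stft1_mul_exp (hω : IsWeightFunction ω) {f : ℝ → ℂ}
    (hf : InSomega ω f) (hw : InSomega ω w) {s k : ℝ} (hs : 0 ≤ s) (hk : 0 ≤ k) :
    Integrable fun z : ℝ × ℝ => ‖stft1 w f z.1 z.2‖ *
      Real.exp (s * (ω |z.1| + ω |z.2|) + k * ω |z.2|) := by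
  obtain ⟨C, hC, h⟩ := hf.exists_stft1_le hω hw (by positivity : 0 < s + k + 1)
  have hI := hω.integrable_prod_exp_neg one_pos one_pos
  have hc := hω.continuous
  refine (hI.const_mul C).mono' ((stronglyMeasurable_stft1 hw.1.continuous
    hf.1.continuous).norm.mul (Continuous.stronglyMeasurable
      (by fun_prop))).aestronglyMeasurable (.of_forall fun z => ?_)
  rw [Real.norm_of_nonneg (by positivity)]
  refine (mul_le_mul_of_nonneg_right (h z) (Real.exp_pos _).le).trans ?_
  rw [mul_assoc, mul_assoc]
  refine mul_le_mul_of_nonneg_left ?_ hC.le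
  rw [← Real.exp_add, ← Real.exp_add, ← Real.exp_add, Real.exp_le_exp]
  have := mul_nonneg hk (hω.nonneg _ (abs_nonneg z.1))
  linarith

theorem InSomega.norm_integral_mul_conj_le (hω : IsWeightFunction ω) {g h : ℝ → ℂ}
    (hg : InSomega ω g) (hw : InSomega ω w) (hh : Continuous h) (hh' : Integrable h)
    {G : ℝ × ℝ → ℝ} (hG : Integrable G)
    (hle : ∀ ζ : ℝ × ℝ, ‖stft1 w g ζ.1 ζ.2‖ * ‖stft1 w h ζ.1 ζ.2‖ ≤ G ζ) :
    ‖∫ x, h x * (starRingEnd ℂ) (g x)‖ * ∫ x, ‖w x‖ ^ 2 ≤ ∫ ζ, G ζ := by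
  have key := hg.integral_comp_mul hω hw (τ := fun x => x) continuous_id
    (p := fun x => (starRingEnd ℂ) (h x)) (Complex.continuous_conj.comp hh)
    ((LinearIsometryEquiv.integrable_comp_iff Complex.conjLIE).2 hh')
  have h1 : ‖∫ x, h x * (starRingEnd ℂ) (g x)‖ = ‖∫ x, g x * (starRingEnd ℂ) (h x)‖ := by
    rw [← Complex.norm_conj, ← integral_conj]
    simp [mul_comm]
  have h2 : 0 ≤ ∫ x, ‖w x‖ ^ 2 := integral_nonneg fun x => by positivity
  have h3 : ∀ ζ : ℝ × ℝ, ‖∫ x, tfShift w ζ x * (starRingEnd ℂ) (h x)‖ =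
      ‖stft1 w h ζ.1 ζ.2‖ := by
    intro ζ
    rw [stft1_eq_integral_tfShift, ← Complex.norm_conj, ← integral_conj]
    simp [mul_comm]
  rw [h1]
  calc _ = ‖(∫ x, g x * (starRingEnd ℂ) (h x)) * ((∫ x, ‖w x‖ ^ 2 : ℝ) : ℂ)‖ := by
        rw [norm_mul, Complex.norm_real, Real.norm_of_nonneg h2]
    _ ≤ _ := by
        rw [key]
        refine norm_integral_le_of_norm_le hG (.of_forall fun ζ => ?_)
        rw [norm_mul, h3]
        exact hle ζ

end Boundedness

/-- boundedness of the composition operator `C_ψ`, `ψ(x) = x + θ(x)`,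
from the ultramodulation space `M¹_{m_{s',k}}(ℝ)` to `M¹_{v_s}(ℝ)`, where
`v_s(z) = e^{s(ω(z₁)+ω(z₂))}` and `m_{s',k}(z) = v_{s'}(z) e^{kω(z₂)}`. -/
theorem stmt13 (ω : ℝ → ℝ) (hω : IsWeightFunction ω)
    (a : ℝ) (ha0 : 0 ≤ a) (ha1 : a < 1)
    (θ : ℝ → ℝ) (hθ : ContDiff ℝ (⊤ : ℕ∞) θ)
    (hθ' : ∀ ℓ : ℕ, 1 ≤ ℓ → ∃ A > 0, ∀ k : ℕ, 1 ≤ k → ∀ x : ℝ,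
      |iteratedDeriv k θ x| ≤ A * Real.exp ((ℓ : ℝ) * youngConj ω ((k : ℝ) / ℓ)))
    (hθa : ∃ C₀ > 0, ∀ x : ℝ, |θ x| ≤ C₀ * (1 + |x|) ^ a)
    (hωa : (fun x : ℝ => ω (x ^ a)) =o[Filter.atTop] ω)
    (w : ℝ → ℂ) (hw : InSomega ω w) (hw0 : w ≠ 0)
    (s s' : ℝ) (hs : 0 < s) (hss' : s < s') :
    ∃ k > 0, ∃ C > 0, ∀ f g : ℝ → ℂ, InSomega ω f → InSomega ω g →
      ‖∫ x : ℝ, f (x + θ x) * (starRingEnd ℂ) (g x)‖ ≤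
        C * (∫ z₁ : ℝ, ∫ z₂ : ℝ, ‖stft1 w f z₁ z₂‖ *
              Real.exp (s' * (ω |z₁| + ω |z₂|) + k * ω |z₂|)) *
          (⨆ z : ℝ × ℝ, ‖stft1 w g z.1 z.2‖ *
              Real.exp (-(s * (ω |z.1| + ω |z.2|)))) := by
  obtain ⟨δ, hδ, k, hk, C, hC, hmat⟩ :=
    exists_stft1_tfShift_comp_le hω ha0 hθ hθ' hθa hωa hw hs hss'
  have hs'0 : 0 < s' := hs.trans hss'
  have hW := hw.integral_norm_sq_pos hω hw0
  have hτ : Continuous fun x => x + θ x := continuous_id.add hθ.continuous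
  set W : ℝ := ∫ x, ‖w x‖ ^ 2
  set J : ℝ := (∫ x, Real.exp (-(δ * ω |x|))) * ∫ x, Real.exp (-(1 * ω |x|)) with hJdef
  have hJ : 0 ≤ J := mul_nonneg (integral_nonneg fun x => (Real.exp_pos _).le)
    (integral_nonneg fun x => (Real.exp_pos _).le)
  have hker : ∀ b : ℝ, Integrable (fun ζ : ℝ × ℝ =>
      Real.exp (-(δ * ω |ζ.1|)) * Real.exp (-(1 * ω |ζ.2 - b|))) ∧
      (∫ ζ : ℝ × ℝ, Real.exp (-(δ * ω |ζ.1|)) * Real.exp (-(1 * ω |ζ.2 - b|))) = J := by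
    intro b
    refine ⟨?_, ?_⟩
    · rw [Measure.volume_eq_prod]
      exact (hω.integrable_exp_neg hδ).mul_prod ((hω.integrable_exp_neg one_pos).comp_sub_right b)
    · rw [Measure.volume_eq_prod, integral_prod_mul (fun x => Real.exp (-(δ * ω |x|)))
        (fun x => Real.exp (-(1 * ω |x - b|))), hJdef,
        integral_sub_right_eq_self (fun x => Real.exp (-(1 * ω |x|)))]
  refine ⟨k, hk, C * (J + 1) / W ^ 2, by positivity, fun f g hf hg => ?_⟩
  have hbdd := hg.bddAbove_stft1_mul_exp hω hw hs.le
  set S : ℝ := ⨆ z : ℝ × ℝ, ‖stft1 w g z.1 z.2‖ * Real.exp (-(s * (ω |z.1| + ω |z.2|)))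
  have hS : 0 ≤ S := Real.iSup_nonneg fun z => by positivity
  have hgS : ∀ ζ : ℝ × ℝ, ‖stft1 w g ζ.1 ζ.2‖ ≤ S * Real.exp (s * (ω |ζ.1| + ω |ζ.2|)) := by
    intro ζ
    have := le_ciSup hbdd ζ
    rwa [Real.exp_neg, ← div_eq_mul_inv, div_le_iff₀ (Real.exp_pos _)] at this
  have hpair : ∀ z : ℝ × ℝ, ‖∫ x, tfShift w z (x + θ x) * (starRingEnd ℂ) (g x)‖ * W ≤
      S * C * J * Real.exp (s' * ω |z.1| + k * ω |z.2|) := by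
    intro z
    obtain ⟨hi, hv⟩ := hker z.2
    refine (hg.norm_integral_mul_conj_le hω hw (h := fun x => tfShift w z (x + θ x))
      ((continuous_tfShift hw.1.continuous).comp
      (continuous_const.prodMk hτ)) (hw.integrable_tfShift_comp hω ha0 hθ hθa hωa z)
      (hi.const_mul (S * (C * Real.exp (s' * ω |z.1| + k * ω |z.2|)))) fun ζ => ?_).trans_eq ?_
    · calc _ ≤ (S * Real.exp (s * (ω |ζ.1| + ω |ζ.2|))) *
            ‖stft1 w (fun x => tfShift w z (x + θ x)) ζ.1 ζ.2‖ := by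
            gcongr
            exact hgS ζ
        _ = S * (‖stft1 w (fun x => tfShift w z (x + θ x)) ζ.1 ζ.2‖ *
            Real.exp (s * (ω |ζ.1| + ω |ζ.2|))) := by ring
        _ ≤ S * (C * Real.exp (s' * ω |z.1| + k * ω |z.2|) *
            (Real.exp (-(δ * ω |ζ.1|)) * Real.exp (-(1 * ω |ζ.2 - z.2|)))) :=
            mul_le_mul_of_nonneg_left (hmat z ζ) hS
        _ = _ := by ring
    · rw [integral_const_mul, hv]
      ring
  have hfint := hf.integrable_norm_stft1_mul_exp hω hw hs'0.le hk.le
  have key := hf.integral_comp_mul hω hw hτ (p := fun x => (starRingEnd ℂ) (g x))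
    hg.conj.1.continuous (hg.conj.integrable hω)
  have hprod : (∫ z : ℝ × ℝ, ‖stft1 w f z.1 z.2‖ *
      Real.exp (s' * (ω |z.1| + ω |z.2|) + k * ω |z.2|)) =
      ∫ z₁ : ℝ, ∫ z₂ : ℝ, ‖stft1 w f z₁ z₂‖ *
        Real.exp (s' * (ω |z₁| + ω |z₂|) + k * ω |z₂|) := by
    rw [Measure.volume_eq_prod] at hfint ⊢
    exact integral_prod _ hfint
  rw [← hprod]
  set I : ℝ := ∫ z : ℝ × ℝ, ‖stft1 w f z.1 z.2‖ *
      Real.exp (s' * (ω |z.1| + ω |z.2|) + k * ω |z.2|)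
  have hI : 0 ≤ I := integral_nonneg fun z => by positivity
  have hmain : ‖∫ x, f (x + θ x) * (starRingEnd ℂ) (g x)‖ * W ≤ S * C * J / W * I := by
    calc _ = ‖(∫ x, f (x + θ x) * (starRingEnd ℂ) (g x)) * (W : ℂ)‖ := by
          rw [norm_mul, Complex.norm_real, Real.norm_of_nonneg hW.le]
      _ ≤ ∫ z : ℝ × ℝ, S * C * J / W * (‖stft1 w f z.1 z.2‖ *
          Real.exp (s' * (ω |z.1| + ω |z.2|) + k * ω |z.2|)) := by
          rw [key]
          refine norm_integral_le_of_norm_le (hfint.const_mul _) (.of_forall fun z => ?_)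
          have h1 := (le_div_iff₀ hW).2 (hpair z)
          have h2 : Real.exp (s' * ω |z.1| + k * ω |z.2|) ≤
              Real.exp (s' * (ω |z.1| + ω |z.2|) + k * ω |z.2|) := by
            rw [Real.exp_le_exp]
            have := mul_nonneg hs'0.le (hω.nonneg _ (abs_nonneg z.2))
            linarith
          rw [norm_mul]
          calc _ ≤ ‖stft1 w f z.1 z.2‖ *
                (S * C * J * Real.exp (s' * (ω |z.1| + ω |z.2|) + k * ω |z.2|) / W) := by
                refine mul_le_mul_of_nonneg_left (h1.trans ?_) (norm_nonneg _)
                gcongr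
            _ = _ := by ring
      _ = _ := integral_const_mul _ _
  rw [← le_div_iff₀ hW] at hmain
  refine hmain.trans ?_
  calc S * C * J / W * I / W = C * J / W ^ 2 * I * S := by field_simp
    _ ≤ C * (J + 1) / W ^ 2 * I * S := by
        gcongr
        linarith
end
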